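/- arXiv:1710.08358 — 3 statements merged into one kernel-verified Lean document; each statement's English description precedes it below -/
import Mathlib

section
/- Let ν be a tail measure with index α > 0 admitting the stochastic representation ν(A) = ∫_0^∞ P(rZ ∈ A) α r^{−α−1} dr, and let C ⊆ E^ℤ be a measurable cone (i.e. x ∈ C implies ux ∈ C for all u > 0). Then ν(C) = 0 if and only if P(Z ∈ C) = 0. If moreover ν is shift-invariant with spectral tail process Θ and C is shift-invariant (BC = C), then ν(C) = 0 if and only if P(Θ ∈ C) = 0. -/
open MeasureTheory
open scoped ENNReal

/-- A measurable cone: a measurable space `E` with a measurable multiplication by positive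
scalars, a zero element and a measurable `1`-homogeneous pseudonorm. -/
structure MeasCone (E : Type*) [MeasurableSpace E] where
  smul : ℝ → E → E
  zero : E
  nrm : E → ℝ
  measurable_smul : Measurable fun p : ℝ × E => smul p.1 p.2
  measurable_nrm : Measurable nrm
  one_smul : ∀ x, smul 1 x = x
  smul_smul : ∀ (u v : ℝ), 0 < u → 0 < v → ∀ x, smul u (smul v x) = smul (u * v) x
  smul_zero' : ∀ (u : ℝ), 0 < u → smul u zero = zero
  nrm_nonneg : ∀ x, 0 ≤ nrm x
  nrm_smul : ∀ (u : ℝ), 0 < u → ∀ x, nrm (smul u x) = u * nrm x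
  eq_zero_of_nrm : ∀ x, nrm x = 0 → x = zero

/-- The `k`-th iterate of the backshift operator: `(B^k x)_h = x_{h-k}`. -/
def seqShift {E : Type*} (k : ℤ) (x : ℤ → E) : ℤ → E := fun h => x (h - k)

/-- Shift invariance of a measure on `E^ℤ`: `ν(BA) = ν(A)` for all measurable `A`. -/
def ShiftInvariant {E : Type*} [MeasurableSpace E] (ν : MeasureTheory.Measure (ℤ → E)) : Prop :=
  ∀ A : Set (ℤ → E), MeasurableSet A → ν (seqShift 1 '' A) = ν A

namespace MeasCone

variable {E : Type*} [MeasurableSpace E] (K : MeasCone E)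

/-- The sequence identically equal to the zero element. -/
def zeroSeq : ℤ → E := fun _ => K.zero

/-- Componentwise scalar multiplication on the sequence space `E^ℤ`. -/
def sSmul (u : ℝ) (x : ℤ → E) : ℤ → E := fun h => K.smul u (x h)


/-- A tail measure with index `α > 0` on `E^ℤ`. -/
def IsTailMeasure (α : ℝ) (ν : Measure (ℤ → E)) : Prop :=
  ν {K.zeroSeq} = 0 ∧
  ν {x | 1 < K.nrm (x 0)} = 1 ∧
  (∀ h : ℤ, ν {x | 1 < K.nrm (x h)} < ⊤) ∧
  ∀ (u : ℝ), 0 < u → ∀ A : Set (ℤ → E), MeasurableSet A →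
    ν (K.sSmul u '' A) = ENNReal.ofReal (u ^ (-α)) * ν A

/-- The spectral map at lag `h`: `x ↦ x / ‖x_h‖`. -/
noncomputable def spectralMap (h : ℤ) (x : ℤ → E) : ℤ → E :=
  fun j => K.smul (K.nrm (x h))⁻¹ (x j)

/-- The law of the local spectral tail process of `ν` at lag `h`:
the pushforward under the spectral map of (the normalization of) the restriction of `ν`
to `{x : ‖x_h‖ > 1}`. -/
noncomputable def spectralLaw (ν : Measure (ℤ → E)) (h : ℤ) : Measure (ℤ → E) :=
  Measure.map (K.spectralMap h)
    ((ν {x | 1 < K.nrm (x h)})⁻¹ • ν.restrict {x | 1 < K.nrm (x h)})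

/-- The time change formula for (the law of) a process `Θ`:
`E[H₀(B^h Θ)] = E[‖Θ_h‖^α H₀(Θ)]` for every measurable `0`-homogeneous
`H₀ : E^ℤ → [0,∞)` vanishing on `{x : ‖x_0‖ = 0}`. -/
def SatisfiesTCF (α : ℝ) (μ : Measure (ℤ → E)) : Prop :=
  ∀ (h : ℤ) (H : (ℤ → E) → ℝ), Measurable H → (∀ x, 0 ≤ H x) →
    (∀ (u : ℝ), 0 < u → ∀ x, H (K.sSmul u x) = H x) →
    (∀ x, K.nrm (x 0) = 0 → H x = 0) →
    ∫⁻ x, ENNReal.ofReal (H (seqShift h x)) ∂μ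
      = ∫⁻ x, ENNReal.ofReal (K.nrm (x h) ^ α) * ENNReal.ofReal (H x) ∂μ

/-- `I(x) = j ∈ ℤ` for the infargmax functional:
`sup_{k ≤ j-1} ‖x_k‖ < ‖x_j‖ = sup_{k ∈ ℤ} ‖x_k‖`. -/
def IsInfArgmax (x : ℤ → E) (j : ℤ) : Prop :=
  (⨆ k : ℤ, ⨆ _ : k < j, ENNReal.ofReal (K.nrm (x k))) < ENNReal.ofReal (K.nrm (x j)) ∧
  ENNReal.ofReal (K.nrm (x j)) = ⨆ k : ℤ, ENNReal.ofReal (K.nrm (x k))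

end MeasCone

namespace MeasCone

section

variable {E : Type*} [MeasurableSpace E] (K : MeasCone E)

theorem sSmul_mem_iff {C : Set (ℤ → E)}
    (hC : ∀ (u : ℝ), 0 < u → ∀ x ∈ C, K.sSmul u x ∈ C) {u : ℝ} (hu : 0 < u) (x : ℤ → E) :
    K.sSmul u x ∈ C ↔ x ∈ C := by
  refine ⟨fun h => ?_, hC u hu x⟩
  have h' := hC u⁻¹ (inv_pos.2 hu) _ h
  have hx : K.sSmul u⁻¹ (K.sSmul u x) = x := by
    funext j
    simp only [sSmul]
    rw [K.smul_smul _ _ (inv_pos.2 hu) hu, inv_mul_cancel₀ hu.ne', K.one_smul]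
  rwa [hx] at h'

theorem measurable_spectralMap (h : ℤ) : Measurable (K.spectralMap h) := by
  refine measurable_pi_lambda _ fun j => ?_
  exact K.measurable_smul.comp
    ((K.measurable_nrm.comp (measurable_pi_apply h)).inv.prodMk (measurable_pi_apply j))

theorem measurableSet_one_lt_nrm (h : ℤ) : MeasurableSet {x : ℤ → E | 1 < K.nrm (x h)} :=
  measurableSet_lt measurable_const (K.measurable_nrm.comp (measurable_pi_apply h))

/-- On a measurable cone `C`, the spectral law at lag `0` of a tail measure `ν` is
`ν(C ∩ {‖x_0‖ > 1})`. -/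
theorem spectralLaw_zero_cone {α : ℝ} {ν : Measure (ℤ → E)} (hν : K.IsTailMeasure α ν)
    {C : Set (ℤ → E)} (hCmeas : MeasurableSet C)
    (hC : ∀ (u : ℝ), 0 < u → ∀ x ∈ C, K.sSmul u x ∈ C) :
    K.spectralLaw ν 0 C = ν (C ∩ {x | 1 < K.nrm (x 0)}) := by
  rw [spectralLaw, Measure.map_apply (K.measurable_spectralMap 0) hCmeas, hν.2.1, inv_one,
    _root_.one_smul, Measure.restrict_apply (K.measurable_spectralMap 0 hCmeas)]
  congr 1
  ext x
  refine and_congr_left fun hx => ?_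
  exact K.sSmul_mem_iff hC (inv_pos.2 (zero_lt_one.trans hx)) x

theorem seqShift_one_image_inter {C : Set (ℤ → E)} (hC : seqShift 1 '' C = C) (h : ℤ) :
    seqShift 1 '' (C ∩ {x | 1 < K.nrm (x h)}) = C ∩ {x | 1 < K.nrm (x (h + 1))} := by
  ext y
  constructor
  · rintro ⟨x, ⟨hx, hx'⟩, rfl⟩
    refine ⟨hC ▸ Set.mem_image_of_mem _ hx, ?_⟩
    simpa [seqShift] using hx'
  · rintro ⟨hy, hy'⟩
    rw [← hC] at hy
    obtain ⟨x, hx, rfl⟩ := hy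
    refine ⟨x, ⟨hx, ?_⟩, rfl⟩
    simpa [seqShift] using hy'

theorem measure_inter_one_lt_nrm_eq {ν : Measure (ℤ → E)} (hν : ShiftInvariant ν)
    {C : Set (ℤ → E)} (hCmeas : MeasurableSet C) (hC : seqShift 1 '' C = C) (h : ℤ) :
    ν (C ∩ {x | 1 < K.nrm (x h)}) = ν (C ∩ {x | 1 < K.nrm (x 0)}) := by
  have step (h : ℤ) :
      ν (C ∩ {x | 1 < K.nrm (x (h + 1))}) = ν (C ∩ {x | 1 < K.nrm (x h)}) := by
    rw [← K.seqShift_one_image_inter hC h]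
    exact hν _ (hCmeas.inter (K.measurableSet_one_lt_nrm h))
  induction h using Int.induction_on with
  | zero => rfl
  | succ i ih => rw [step, ih]
  | pred i ih => rw [← ih, ← step, sub_add_cancel]

/-- A cone is covered by the zero sequence and the scaled exceedance sets
`u • (C ∩ {‖x_h‖ > 1})`. -/
theorem cone_subset {C : Set (ℤ → E)}
    (hC : ∀ (u : ℝ), 0 < u → ∀ x ∈ C, K.sSmul u x ∈ C) :
    C ⊆ {K.zeroSeq} ∪
      ⋃ (h : ℤ) (n : ℕ), K.sSmul (1 / ((n : ℝ) + 1)) '' (C ∩ {x | 1 < K.nrm (x h)}) := by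
  intro x hx
  by_cases h0 : ∀ h, K.nrm (x h) = 0
  · exact Or.inl (funext fun h => K.eq_zero_of_nrm _ (h0 h))
  · right
    push Not at h0
    obtain ⟨h, hh⟩ := h0
    have hpos : 0 < K.nrm (x h) := lt_of_le_of_ne (K.nrm_nonneg _) hh.symm
    obtain ⟨n, hn⟩ := exists_nat_one_div_lt hpos
    have hn1 : (0 : ℝ) < (n : ℝ) + 1 := by positivity
    refine Set.mem_iUnion₂.2 ⟨h, n, K.sSmul ((n : ℝ) + 1) x, ⟨hC _ hn1 x hx, ?_⟩, ?_⟩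
    · simp only [sSmul, Set.mem_ofPred_eq]
      rw [K.nrm_smul _ hn1]
      rwa [div_lt_iff₀' hn1] at hn
    · funext j
      simp only [sSmul]
      rw [K.smul_smul _ _ (by positivity) hn1, one_div, inv_mul_cancel₀ hn1.ne', K.one_smul]

theorem measure_cone_eq_zero {α : ℝ} {ν : Measure (ℤ → E)} (hν : K.IsTailMeasure α ν)
    {C : Set (ℤ → E)} (hCmeas : MeasurableSet C)
    (hC : ∀ (u : ℝ), 0 < u → ∀ x ∈ C, K.sSmul u x ∈ C)
    (hzero : ∀ h : ℤ, ν (C ∩ {x | 1 < K.nrm (x h)}) = 0) : ν C = 0 := by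
  refine measure_mono_null (K.cone_subset hC) (measure_union_null hν.1 ?_)
  refine measure_iUnion_null fun h => measure_iUnion_null fun n => ?_
  rw [hν.2.2.2 _ (by positivity) _ (hCmeas.inter (K.measurableSet_one_lt_nrm h)), hzero h,
    mul_zero]

end

end MeasCone

theorem lintegral_Ioi_rpow_ne_zero {α : ℝ} (hα : 0 < α) :
    ∫⁻ r in Set.Ioi (0 : ℝ), ENNReal.ofReal (α * r ^ (-α - 1)) ≠ 0 := by
  refine ((setLIntegral_pos_iff (by fun_prop)).2 ?_).ne'
  have hsub : Set.Ioi (0 : ℝ) ⊆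
      (Function.support fun r : ℝ => ENNReal.ofReal (α * r ^ (-α - 1))) ∩ Set.Ioi 0 :=
    fun r hr => ⟨(ENNReal.ofReal_pos.2 (mul_pos hα (Real.rpow_pos_of_pos hr _))).ne', hr⟩
  refine lt_of_lt_of_le ?_ (measure_mono hsub)
  simp

open MeasCone in
/-- for a tail measure with stochastic representation given by `Z` and a
measurable cone `C`, `ν(C) = 0 ↔ P(Z ∈ C) = 0`; if moreover `ν` is shift-invariant and `C` is
shift-invariant then `ν(C) = 0 ↔ P(Θ ∈ C) = 0`. -/
theorem tailMeasure_cone_null_iff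
    {E : Type*} [MeasurableSpace E] (K : MeasCone E) (α : ℝ) (hα : 0 < α)
    {Ω : Type*} [MeasurableSpace Ω] (P : Measure Ω) [IsProbabilityMeasure P]
    (Z : Ω → ℤ → E) (hZmeas : Measurable Z)
    (hZzero : P {ω | Z ω = K.zeroSeq} = 0)
    (hZone : ∫⁻ ω, ENNReal.ofReal (K.nrm (Z ω 0) ^ α) ∂P = 1)
    (hZfin : ∀ h : ℤ, ∫⁻ ω, ENNReal.ofReal (K.nrm (Z ω h) ^ α) ∂P < ⊤)
    (ν : Measure (ℤ → E)) (hνtail : K.IsTailMeasure α ν)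
    (hν : ∀ A : Set (ℤ → E), MeasurableSet A →
      ν A = ∫⁻ r in Set.Ioi (0 : ℝ),
        P {ω | K.sSmul r (Z ω) ∈ A} * ENNReal.ofReal (α * r ^ (-α - 1)) ∂volume)
    (C : Set (ℤ → E)) (hCmeas : MeasurableSet C)
    (hCcone : ∀ (u : ℝ), 0 < u → ∀ x ∈ C, K.sSmul u x ∈ C) :
    (ν C = 0 ↔ P {ω | Z ω ∈ C} = 0) ∧
      (ShiftInvariant ν → seqShift 1 '' C = C →
        (ν C = 0 ↔ K.spectralLaw ν 0 C = 0)) := by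
  constructor
  · have key : ν C = P {ω | Z ω ∈ C} *
        ∫⁻ r in Set.Ioi (0 : ℝ), ENNReal.ofReal (α * r ^ (-α - 1)) := by
      rw [hν C hCmeas, ← lintegral_const_mul _ (by fun_prop)]
      refine setLIntegral_congr_fun measurableSet_Ioi fun r hr => ?_
      simp only [K.sSmul_mem_iff hCcone hr]
    rw [key, mul_eq_zero, or_iff_left (lintegral_Ioi_rpow_ne_zero hα)]
  · intro hshift hCshift
    rw [K.spectralLaw_zero_cone hνtail hCmeas hCcone]
    refine ⟨fun h => measure_mono_null Set.inter_subset_left h, fun h => ?_⟩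
    refine K.measure_cone_eq_zero hνtail hCmeas hCcone fun k => ?_
    rw [K.measure_inter_one_lt_nrm_eq hshift hCmeas hCshift, h]
end

section
/- Let ν be a shift-invariant tail measure with index α > 0 on E^ℤ. The following statements are equivalent: (i) the dynamical system (E^ℤ, C, ν, B) is dissipative; (ii) ν has a moving shift representation; (iii) ν is supported by {x : Σ_{h∈ℤ} ‖x_h‖^α < ∞}; (iv) ν is supported by {x : lim_{|h|→∞} ‖x_h‖ = 0}; (v) ν is supported by {x : I(x) ∈ ℤ}. -/
open MeasureTheory
open scoped ENNReal

section SeqShift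

variable {E : Type*}

lemma seqShift_seqShift (h k : ℤ) (x : ℤ → E) :
    seqShift h (seqShift k x) = seqShift (h + k) x := by
  funext j
  simp only [seqShift]
  congr 1
  ring

lemma seqShift_zero (x : ℤ → E) : seqShift 0 x = x := by
  funext j
  simp [seqShift]

lemma image_seqShift (h : ℤ) (A : Set (ℤ → E)) : seqShift h '' A = seqShift (-h) ⁻¹' A := by
  refine congrFun (Set.image_eq_preimage_of_inverse ?_ ?_) A <;> intro x <;>
    simp [seqShift_seqShift, seqShift_zero]

variable [MeasurableSpace E]

lemma measurable_seqShift (h : ℤ) : Measurable (seqShift h : (ℤ → E) → ℤ → E) :=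
  measurable_pi_lambda _ fun j => measurable_pi_apply (j - h)

lemma ShiftInvariant.measure_preimage {ν : Measure (ℤ → E)} (hs : ShiftInvariant ν) (h : ℤ)
    {A : Set (ℤ → E)} (hA : MeasurableSet A) : ν (seqShift h ⁻¹' A) = ν A := by
  have hneg : ∀ B : Set (ℤ → E), MeasurableSet B → ν (seqShift (-1) ⁻¹' B) = ν B := fun B hB => by
    rw [← image_seqShift, hs B hB]
  have hpos : ∀ B : Set (ℤ → E), MeasurableSet B → ν (seqShift 1 ⁻¹' B) = ν B := fun B hB => by
    rw [← hneg _ (measurable_seqShift 1 hB), ← Set.preimage_comp]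
    congr 1
    ext x
    simp [seqShift_seqShift, seqShift_zero]
  have hadd : ∀ k l : ℤ, seqShift (k + l) ⁻¹' A = seqShift l ⁻¹' (seqShift k ⁻¹' A) :=
    fun k l => by
      ext x
      simp [seqShift_seqShift]
  induction h using Int.induction_on with
  | zero =>
    congr 1
    ext x
    simp [seqShift_zero]
  | succ n ih => rw [hadd, hpos _ (measurable_seqShift _ hA), ih]
  | pred n ih => rw [sub_eq_add_neg, hadd, hneg _ (measurable_seqShift _ hA), ih]

end SeqShift

lemma lintegral_Ioi_comp_mul_left (G : ℝ → ℝ≥0∞) {c : ℝ} (hc : 0 < c) :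
    ∫⁻ r in Set.Ioi (0 : ℝ), G r = ∫⁻ s in Set.Ioi (0 : ℝ), ENNReal.ofReal c * G (c * s) := by
  have himage : (fun s : ℝ => c * s) '' Set.Ioi 0 = Set.Ioi 0 := by
    rw [Set.image_mul_left_Ioi hc, mul_zero]
  have hderiv : ∀ x ∈ Set.Ioi (0 : ℝ),
      HasDerivWithinAt (fun s : ℝ => c * s) c (Set.Ioi 0) x := fun x _ => by
    simpa using ((hasDerivAt_id x).const_mul c).hasDerivWithinAt
  have hinj : Set.InjOn (fun s : ℝ => c * s) (Set.Ioi 0) :=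
    (mul_right_injective₀ hc.ne').injOn
  have := lintegral_image_eq_lintegral_abs_deriv_mul measurableSet_Ioi hderiv hinj G
  rwa [himage, abs_of_pos hc] at this

lemma lintegral_Ioi_mul_rpow {α : ℝ} (hα : 0 < α) {t : ℝ} (ht : 0 < t) :
    ∫⁻ r in Set.Ioi t, ENNReal.ofReal (α * r ^ (-α - 1)) = ENNReal.ofReal (t ^ (-α)) := by
  rw [← ofReal_integral_eq_lintegral_ofReal]
  · rw [integral_const_mul, integral_Ioi_rpow_of_lt (by linarith) ht]
    congr 1
    rw [sub_add_cancel]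
    field_simp
  · exact (integrableOn_Ioi_rpow_of_lt (by linarith) ht).const_mul α
  · filter_upwards [ae_restrict_mem measurableSet_Ioi] with r hr
    have : 0 < r := ht.trans hr
    positivity

lemma lintegral_Ioc_mul_rpow {α : ℝ} (hα : 0 < α) {t : ℝ} (ht : 0 < t) :
    ∫⁻ r in Set.Ioc 0 t, ENNReal.ofReal (α * r ^ (α - 1)) = ENNReal.ofReal (t ^ α) := by
  rw [← ofReal_integral_eq_lintegral_ofReal]
  · rw [integral_const_mul, ← intervalIntegral.integral_of_le ht.le,
      integral_rpow (Or.inl (by linarith))]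
    congr 1
    rw [sub_add_cancel, Real.zero_rpow hα.ne']
    field_simp
    ring
  · exact ((intervalIntegrable_iff_integrableOn_Ioc_of_le ht.le).1
      (intervalIntegral.intervalIntegrable_rpow' (by linarith))).const_mul α
  · filter_upwards [ae_restrict_mem measurableSet_Ioc] with r hr
    have : 0 < r := hr.1
    positivity

namespace MeasCone

section Basic

variable {E : Type*} [MeasurableSpace E] (K : MeasCone E)

lemma nrm_zero : K.nrm K.zero = 0 := by
  have h := K.nrm_smul 2 two_pos K.zero
  rw [K.smul_zero' 2 two_pos] at h
  linarith

lemma measurable_nrm_apply (h : ℤ) : Measurable fun x : ℤ → E => K.nrm (x h) :=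
  K.measurable_nrm.comp (measurable_pi_apply h)

lemma measurable_sSmul_prod : Measurable fun p : ℝ × (ℤ → E) => K.sSmul p.1 p.2 :=
  measurable_pi_lambda _ fun h => K.measurable_smul.comp
    (measurable_fst.prodMk ((measurable_pi_apply h).comp measurable_snd))

lemma measurable_sSmul (u : ℝ) : Measurable (K.sSmul u) :=
  K.measurable_sSmul_prod.comp measurable_prodMk_left

lemma sSmul_sSmul {u v : ℝ} (hu : 0 < u) (hv : 0 < v) (x : ℤ → E) :
    K.sSmul u (K.sSmul v x) = K.sSmul (u * v) x :=
  funext fun h => K.smul_smul u v hu hv (x h)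

lemma sSmul_one (x : ℤ → E) : K.sSmul 1 x = x :=
  funext fun h => K.one_smul (x h)

lemma nrm_sSmul {u : ℝ} (hu : 0 < u) (x : ℤ → E) (h : ℤ) :
    K.nrm (K.sSmul u x h) = u * K.nrm (x h) :=
  K.nrm_smul u hu (x h)

lemma image_sSmul {u : ℝ} (hu : 0 < u) (A : Set (ℤ → E)) :
    K.sSmul u '' A = K.sSmul u⁻¹ ⁻¹' A := by
  have hu' : 0 < u⁻¹ := inv_pos.2 hu
  refine congrFun (Set.image_eq_preimage_of_inverse ?_ ?_) A <;> intro x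
  · rw [K.sSmul_sSmul hu' hu, inv_mul_cancel₀ hu.ne', K.sSmul_one]
  · rw [K.sSmul_sSmul hu hu', mul_inv_cancel₀ hu.ne', K.sSmul_one]

variable {K}

lemma eq_zeroSeq {x : ℤ → E} (hx : ∀ h, K.nrm (x h) ≤ 0) : x = K.zeroSeq :=
  funext fun h => K.eq_zero_of_nrm _ ((hx h).antisymm (K.nrm_nonneg _))

variable {α : ℝ} {ν : Measure (ℤ → E)}

lemma IsTailMeasure.map_sSmul (hν : K.IsTailMeasure α ν) {u : ℝ} (hu : 0 < u) :
    ν.map (K.sSmul u) = ENNReal.ofReal (u ^ α) • ν := by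
  ext A hA
  have hu' : 0 < u⁻¹ := inv_pos.2 hu
  have h := hν.2.2.2 u⁻¹ hu' A hA
  rw [K.image_sSmul hu', inv_inv, Real.inv_rpow hu.le, Real.rpow_neg hu.le, inv_inv] at h
  rw [Measure.map_apply (K.measurable_sSmul u) hA, h, Measure.smul_apply, smul_eq_mul]

lemma map_sSmul_restrict {u : ℝ} (hu : 0 < u) {c : ℝ≥0∞} (hmap : ν.map (K.sSmul u) = c • ν)
    {C : Set (ℤ → E)} (hC : MeasurableSet C)
    (hcone : ∀ u : ℝ, 0 < u → ∀ x ∈ C, K.sSmul u x ∈ C) :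
    (ν.restrict C).map (K.sSmul u) = c • ν.restrict C := by
  have hpre : K.sSmul u ⁻¹' C = C := by
    ext x
    refine ⟨fun hx => ?_, hcone u hu x⟩
    have := hcone u⁻¹ (inv_pos.2 hu) _ hx
    rwa [K.sSmul_sSmul (inv_pos.2 hu) hu, inv_mul_cancel₀ hu.ne', K.sSmul_one] at this
  rw [← Measure.restrict_smul, ← hmap, Measure.restrict_map (K.measurable_sSmul u) hC, hpre]

end Basic

section Polar

variable {E : Type*} [MeasurableSpace E] {K : MeasCone E} {α : ℝ} {μ : Measure (ℤ → E)}

lemma measure_rpow_scaling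
    (hmap : ∀ u : ℝ, 0 < u → μ.map (K.sSmul u) = ENNReal.ofReal (u ^ α) • μ)
    {q : (ℤ → E) → ℝ} (hq : Measurable q)
    (hq_smul : ∀ u : ℝ, 0 < u → ∀ x, q (K.sSmul u x) = u * q x)
    {t : ℝ} (ht : 0 < t) :
    μ {x | t < q x} = ENNReal.ofReal (t ^ (-α)) * μ {x | 1 < q x} := by
  have hpre : K.sSmul t⁻¹ ⁻¹' {x | 1 < q x} = {x | t < q x} := by
    ext x
    simp [hq_smul _ (inv_pos.2 ht), lt_inv_mul_iff₀ ht]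
  have h := congrArg (fun m : Measure (ℤ → E) => m {x | 1 < q x}) (hmap t⁻¹ (inv_pos.2 ht))
  simp only [Measure.smul_apply, smul_eq_mul] at h
  rwa [Measure.map_apply (K.measurable_sSmul _) (measurableSet_lt measurable_const hq), hpre,
    Real.inv_rpow ht.le, ← Real.rpow_neg ht.le] at h

lemma sigmaFinite_of_modulus
    (hmap : ∀ u : ℝ, 0 < u → μ.map (K.sSmul u) = ENNReal.ofReal (u ^ α) • μ)
    {q : (ℤ → E) → ℝ} (hq : Measurable q)
    (hq_smul : ∀ u : ℝ, 0 < u → ∀ x, q (K.sSmul u x) = u * q x)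
    (hq_pos : ∀ᵐ x ∂μ, 0 < q x) (hq_one : μ {x | 1 < q x} < ∞) : SigmaFinite μ := by
  refine ⟨⟨⟨fun n : ℕ => {x | (1 / (n + 1) : ℝ) < q x} ∪ {x | ¬ 0 < q x}, fun _ => trivial,
    fun n => ?_, ?_⟩⟩⟩
  · have hn : (0 : ℝ) < 1 / (n + 1) := Nat.one_div_pos_of_nat
    refine (measure_union_le _ _).trans_lt ?_
    rw [ae_iff.1 hq_pos, add_zero, measure_rpow_scaling hmap hq hq_smul hn]
    exact ENNReal.mul_lt_top ENNReal.ofReal_lt_top hq_one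
  · refine Set.eq_univ_of_forall fun x => Set.mem_iUnion.2 ?_
    by_cases hx : 0 < q x
    · obtain ⟨n, hn⟩ := exists_nat_one_div_lt hx
      exact ⟨n, Or.inl hn⟩
    · exact ⟨0, Or.inr hx⟩

/-- Polar decomposition of an `α`-homogeneous measure with respect to a modulus `q`. -/
lemma exists_polar_decomposition (hα : 0 < α)
    (hmap : ∀ u : ℝ, 0 < u → μ.map (K.sSmul u) = ENNReal.ofReal (u ^ α) • μ)
    {q : (ℤ → E) → ℝ} (hq : Measurable q)
    (hq_smul : ∀ u : ℝ, 0 < u → ∀ x, q (K.sSmul u x) = u * q x)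
    (hq_pos : ∀ᵐ x ∂μ, 0 < q x) (hq_one : μ {x | 1 < q x} = 1) :
    ∃ ρ : Measure (ℤ → E), IsProbabilityMeasure ρ ∧ ∀ A : Set (ℤ → E), MeasurableSet A →
      μ A = ∫⁻ r in Set.Ioi (0 : ℝ),
        ρ {z | K.sSmul r z ∈ A} * ENNReal.ofReal (α * r ^ (-α - 1)) := by
  have hsf : SigmaFinite μ :=
    sigmaFinite_of_modulus hmap hq hq_smul hq_pos (hq_one ▸ ENNReal.one_lt_top)
  set Q : Set (ℤ → E) := {x | 1 < q x} with hQdef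
  have hQ : MeasurableSet Q := measurableSet_lt measurable_const hq
  set T : (ℤ → E) → ℤ → E := fun x => K.sSmul (q x)⁻¹ x with hTdef
  have hT : Measurable T := K.measurable_sSmul_prod.comp (hq.inv.prodMk measurable_id)
  set w : ℝ → ℝ≥0∞ := fun r => ENNReal.ofReal (α * r ^ (-α - 1)) with hwdef
  have hw : Measurable w := by fun_prop
  refine ⟨(μ.restrict Q).map T, ⟨?_⟩, fun A hA => ?_⟩
  · rw [Measure.map_apply hT MeasurableSet.univ, Set.preimage_univ, Measure.restrict_apply_univ,
      hq_one]
  set f : (ℤ → E) → ℝ≥0∞ := A.indicator 1 with hfdef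
  have hf : Measurable f := measurable_one.indicator hA
  set g : ℝ → (ℤ → E) → ℝ≥0∞ := fun s y =>
    {p : ℝ × (ℤ → E) | p.1 < q p.2}.indicator 1 (s, y) * f y
      * ENNReal.ofReal ((q y / s) ^ (-α)) * w s with hgdef
  have hg : Measurable (Function.uncurry g) := by
    have h1 : Measurable fun p : ℝ × (ℤ → E) =>
        ({p : ℝ × (ℤ → E) | p.1 < q p.2}.indicator 1 p : ℝ≥0∞) :=
      measurable_one.indicator (measurableSet_lt measurable_fst (hq.comp measurable_snd))
    have h2 : Measurable fun p : ℝ × (ℤ → E) => (q p.2 / p.1) ^ (-α) :=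
      ((hq.comp measurable_snd).div measurable_fst).pow_const _
    exact ((h1.mul (hf.comp measurable_snd)).mul h2.ennreal_ofReal).mul (hw.comp measurable_fst)
  have hg_lt : ∀ {s y}, s < q y →
      g s y = f y * ENNReal.ofReal ((q y / s) ^ (-α)) * w s := fun h => by simp [hgdef, h]
  have hg_ge : ∀ {s y}, ¬ s < q y → g s y = 0 := fun h => by simp [hgdef, h]
  symm
  calc ∫⁻ r in Set.Ioi (0 : ℝ), (μ.restrict Q).map T {z | K.sSmul r z ∈ A} * w r
      = ∫⁻ r in Set.Ioi (0 : ℝ), ∫⁻ x in Q, f (K.sSmul r (T x)) * w r ∂μ := by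
        refine lintegral_congr fun r => ?_
        have hB : MeasurableSet {z | K.sSmul r z ∈ A} := K.measurable_sSmul r hA
        have hfr : Measurable fun x => f (K.sSmul r (T x)) :=
          hf.comp ((K.measurable_sSmul r).comp hT)
        rw [lintegral_mul_const _ hfr,
          Measure.map_apply hT hB, ← lintegral_indicator_one (hT hB)]
        rfl
    _ = ∫⁻ x in Q, (∫⁻ r in Set.Ioi (0 : ℝ), f (K.sSmul r (T x)) * w r ∂volume) ∂μ := by
        refine lintegral_lintegral_swap (Measurable.aemeasurable ?_)
        exact (hf.comp (K.measurable_sSmul_prod.comp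
          (measurable_fst.prodMk (hT.comp measurable_snd)))).mul (hw.comp measurable_fst)
    _ = ∫⁻ x in Q, (∫⁻ s in Set.Ioi (0 : ℝ), g s (K.sSmul s x) ∂volume) ∂μ := by
        refine setLIntegral_congr_fun hQ fun x hx => ?_
        have hqx : 0 < q x := one_pos.trans hx
        rw [lintegral_Ioi_comp_mul_left _ hqx]
        refine setLIntegral_congr_fun measurableSet_Ioi fun s (hs : 0 < s) => ?_
        have hmem : s < q (K.sSmul s x) := by
          rw [hq_smul s hs]
          exact (lt_mul_iff_one_lt_right hs).2 hx
        have hw' : ENNReal.ofReal (q x) * w (q x * s) = ENNReal.ofReal ((q x) ^ (-α)) * w s := by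
          simp only [hwdef]
          rw [← ENNReal.ofReal_mul hqx.le, ← ENNReal.ofReal_mul (by positivity),
            Real.mul_rpow hqx.le hs.le, Real.rpow_sub hqx, Real.rpow_one]
          congr 1
          field_simp
        rw [hg_lt hmem, hq_smul s hs, mul_div_cancel_left₀ _ hs.ne', mul_left_comm, hw', mul_assoc]
        simp only [hTdef]
        rw [K.sSmul_sSmul (mul_pos hqx hs) (inv_pos.2 hqx), mul_right_comm,
          mul_inv_cancel₀ hqx.ne', one_mul]
    _ = ∫⁻ x, (∫⁻ s in Set.Ioi (0 : ℝ), g s (K.sSmul s x) ∂volume) ∂μ := by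
        rw [← lintegral_indicator hQ]
        refine lintegral_congr fun x => ?_
        by_cases hx : x ∈ Q
        · rw [Set.indicator_of_mem hx]
        rw [Set.indicator_of_notMem hx, eq_comm]
        refine (setLIntegral_congr_fun measurableSet_Ioi fun s (hs : 0 < s) => ?_).trans
          lintegral_zero
        refine hg_ge fun h => hx ?_
        rw [hq_smul s hs] at h
        exact (lt_mul_iff_one_lt_right hs).1 h
    _ = ∫⁻ s in Set.Ioi (0 : ℝ), ∫⁻ x, g s (K.sSmul s x) ∂μ := by
        refine lintegral_lintegral_swap (Measurable.aemeasurable ?_)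
        exact hg.comp (measurable_snd.prodMk (K.measurable_sSmul_prod.comp measurable_swap))
    _ = ∫⁻ s in Set.Ioi (0 : ℝ), ∫⁻ y, ENNReal.ofReal (s ^ α) * g s y ∂μ := by
        refine setLIntegral_congr_fun measurableSet_Ioi fun s (hs : 0 < s) => ?_
        have hgs : Measurable (g s) := hg.comp measurable_prodMk_left
        rw [← lintegral_map hgs (K.measurable_sSmul s), hmap s hs, lintegral_smul_measure,
          lintegral_const_mul _ hgs, smul_eq_mul]
    _ = ∫⁻ y, (∫⁻ s in Set.Ioi (0 : ℝ), ENNReal.ofReal (s ^ α) * g s y ∂volume) ∂μ := by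
        refine lintegral_lintegral_swap (Measurable.aemeasurable ?_)
        exact ((measurable_fst.pow_const α).ennreal_ofReal).mul hg
    _ = ∫⁻ y, f y ∂μ := by
        refine lintegral_congr_ae ?_
        filter_upwards [hq_pos] with y hy
        have hint : ∀ s ∈ Set.Ioi (0 : ℝ), ENNReal.ofReal (s ^ α) * g s y
            = (Set.Iio (q y)).indicator (fun s => f y * ENNReal.ofReal ((q y) ^ (-α))
              * ENNReal.ofReal (α * s ^ (α - 1))) s := fun s (hs : 0 < s) => by
          by_cases hsq : s < q y
          · rw [Set.indicator_of_mem (Set.mem_Iio.2 hsq)]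
            rw [hg_lt hsq, mul_assoc, mul_left_comm, mul_assoc, ← ENNReal.ofReal_mul (by positivity),
              ← ENNReal.ofReal_mul (by positivity), ← ENNReal.ofReal_mul (by positivity),
              Real.div_rpow hy.le hs.le, Real.rpow_neg hs.le, Real.rpow_sub hs, Real.rpow_sub hs,
              Real.rpow_neg hs.le]
            congr 2
            field_simp
          · rw [Set.indicator_of_notMem (by simpa using hsq), hg_ge hsq, mul_zero]
        rw [setLIntegral_congr_fun measurableSet_Ioi hint, lintegral_indicator measurableSet_Iio,
          Measure.restrict_restrict measurableSet_Iio, Set.Iio_inter_Ioi,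
          lintegral_const_mul _ (by fun_prop), Measure.restrict_congr_set Ioo_ae_eq_Ioc,
          lintegral_Ioc_mul_rpow hα hy, mul_assoc, ← ENNReal.ofReal_mul (by positivity),
          ← Real.rpow_add hy]
        simp
    _ = μ A := lintegral_indicator_one hA

end Polar

section InfArgmax

variable {E : Type*} [MeasurableSpace E] {K : MeasCone E}

lemma IsInfArgmax.nrm_pos {x : ℤ → E} {j : ℤ} (h : K.IsInfArgmax x j) : 0 < K.nrm (x j) :=
  ENNReal.ofReal_pos.1 (bot_le.trans_lt h.1)

lemma IsInfArgmax.unique {x : ℤ → E} {i j : ℤ} (hi : K.IsInfArgmax x i)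
    (hj : K.IsInfArgmax x j) : i = j := by
  have key : ∀ i j : ℤ, K.IsInfArgmax x i → K.IsInfArgmax x j → ¬ i < j := fun i j hi hj hij =>
    ((le_iSup₂ (f := fun k (_ : k < j) => ENNReal.ofReal (K.nrm (x k))) i hij).trans_lt hj.1).ne
      (hi.2.trans hj.2.symm)
  exact le_antisymm (not_lt.1 (key _ _ hj hi)) (not_lt.1 (key _ _ hi hj))

lemma isInfArgmax_seqShift {x : ℤ → E} {h j : ℤ} :
    K.IsInfArgmax (seqShift h x) j ↔ K.IsInfArgmax x (j - h) := by
  have h1 : (⨆ k : ℤ, ⨆ _ : k < j, ENNReal.ofReal (K.nrm (seqShift h x k)))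
      = ⨆ k : ℤ, ⨆ _ : k < j - h, ENNReal.ofReal (K.nrm (x k)) :=
    (Equiv.subRight h).iSup_congr fun k => by simp [seqShift]
  have h2 : (⨆ k : ℤ, ENNReal.ofReal (K.nrm (seqShift h x k)))
      = ⨆ k : ℤ, ENNReal.ofReal (K.nrm (x k)) :=
    (Equiv.subRight h).iSup_congr fun k => by simp [seqShift]
  rw [IsInfArgmax, IsInfArgmax, h1, h2]
  rfl

lemma isInfArgmax_sSmul {x : ℤ → E} {j : ℤ} {u : ℝ} (hu : 0 < u) (h : K.IsInfArgmax x j) :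
    K.IsInfArgmax (K.sSmul u x) j := by
  have hmul : ∀ k, ENNReal.ofReal (K.nrm (K.sSmul u x k))
      = ENNReal.ofReal u * ENNReal.ofReal (K.nrm (x k)) := fun k => by
    rw [K.nrm_sSmul hu, ENNReal.ofReal_mul hu.le]
  simp only [IsInfArgmax, hmul, ← ENNReal.mul_iSup]
  exact ⟨(ENNReal.mul_lt_mul_iff_right (ENNReal.ofReal_pos.2 hu).ne' ENNReal.ofReal_ne_top).2 h.1,
    congrArg _ h.2⟩

lemma measurableSet_isInfArgmax (j : ℤ) : MeasurableSet {x : ℤ → E | K.IsInfArgmax x j} := by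
  have hm : ∀ k : ℤ, Measurable fun x : ℤ → E => ENNReal.ofReal (K.nrm (x k)) :=
    fun k => (K.measurable_nrm_apply k).ennreal_ofReal
  exact (measurableSet_lt (.iSup fun k => .iSup_Prop _ (hm k)) (hm j)).inter
    (measurableSet_eq_fun (hm j) (.iSup hm))

lemma image_seqShift_isInfArgmax (h : ℤ) :
    seqShift h '' {x : ℤ → E | K.IsInfArgmax x 0} = {x | K.IsInfArgmax x h} := by
  ext x
  simp [image_seqShift, isInfArgmax_seqShift]

lemma exists_isInfArgmax_of_tendsto {x : ℤ → E} (hx : x ≠ K.zeroSeq)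
    (hlim : Filter.Tendsto (fun h : ℤ => K.nrm (x h)) Filter.cofinite (nhds 0)) :
    ∃ j, K.IsInfArgmax x j := by
  have hfin : ∀ ε : ℝ, 0 < ε → {h : ℤ | ε ≤ K.nrm (x h)}.Finite := fun ε hε => by
    simpa only [not_lt] using Filter.eventually_cofinite.1 (hlim.eventually (gt_mem_nhds hε))
  obtain ⟨k, hk⟩ : ∃ k, 0 < K.nrm (x k) := by
    by_contra! h
    exact hx (eq_zeroSeq h)
  obtain ⟨m, hkm, hmax⟩ := (hfin _ hk).toFinset.exists_max_image (fun h => K.nrm (x h))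
    ⟨k, by simp⟩
  have hmax' : ∀ h, K.nrm (x h) ≤ K.nrm (x m) := fun h => by
    rcases le_total (K.nrm (x k)) (K.nrm (x h)) with hh | hh
    · exact hmax h (by simpa using hh)
    · exact hh.trans (by simpa using hkm)
  have hm : 0 < K.nrm (x m) := hk.trans_le (hmax' k)
  obtain ⟨j, hj, hjmin⟩ := (hfin _ hm).toFinset.exists_min_image id ⟨m, by simp⟩
  have hjm : K.nrm (x j) = K.nrm (x m) := (hmax' j).antisymm (by simpa using hj)
  refine ⟨j, ?_, le_antisymm (le_iSup (fun k => ENNReal.ofReal (K.nrm (x k))) j)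
    (iSup_le fun k => ENNReal.ofReal_le_ofReal (hjm ▸ hmax' k))⟩
  have hlt : ∀ h < j, K.nrm (x h) < K.nrm (x m) := fun h hh => by
    by_contra! hle
    exact (hjmin h (by simpa using hle)).not_gt hh
  obtain ⟨b, hb, hbound⟩ : ∃ b < K.nrm (x m), ∀ h < j, K.nrm (x h) ≤ b := by
    rcases ((hfin _ (half_pos hm)).toFinset.filter (· < j)).eq_empty_or_nonempty with he | hne
    · refine ⟨K.nrm (x m) / 2, half_lt_self hm, fun h hh => ?_⟩
      by_contra! hc
      exact (Finset.eq_empty_iff_forall_notMem.1 he h) (by simp [hh, hc.le])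
    · obtain ⟨i, hi, himax⟩ := Finset.exists_max_image _ (fun h => K.nrm (x h)) hne
      simp only [Finset.mem_filter, Set.Finite.mem_toFinset, Set.mem_ofPred_eq] at hi himax
      refine ⟨K.nrm (x i), hlt i hi.2, fun h hh => ?_⟩
      rcases le_total (K.nrm (x m) / 2) (K.nrm (x h)) with hc | hc
      · exact himax h ⟨hc, hh⟩
      · exact hc.trans hi.1
  refine (iSup₂_le fun h hh => ENNReal.ofReal_le_ofReal (hbound h hh)).trans_lt ?_
  rw [hjm]
  exact (ENNReal.ofReal_lt_ofReal_iff hm).2 hb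

end InfArgmax

section Summability

variable {E : Type*} [MeasurableSpace E] {K : MeasCone E} {α : ℝ}

lemma tendsto_nrm_of_tsum_lt_top (hα : 0 < α) {x : ℤ → E}
    (hx : (∑' h : ℤ, ENNReal.ofReal (K.nrm (x h) ^ α)) < ∞) :
    Filter.Tendsto (fun h : ℤ => K.nrm (x h)) Filter.cofinite (nhds 0) := by
  have h1 := (ENNReal.tendsto_toReal ENNReal.zero_ne_top).comp
    (ENNReal.tendsto_cofinite_zero_of_tsum_ne_top hx.ne)
  have h2 : Filter.Tendsto (fun h : ℤ => K.nrm (x h) ^ α) Filter.cofinite (nhds 0) :=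
    h1.congr fun h => ENNReal.toReal_ofReal (Real.rpow_nonneg (K.nrm_nonneg _) _)
  have h3 := h2.rpow_const (p := α⁻¹) (Or.inr (inv_pos.2 hα).le)
  rw [Real.zero_rpow (inv_pos.2 hα).ne'] at h3
  exact h3.congr fun h => Real.rpow_rpow_inv (K.nrm_nonneg _) hα.ne'

lemma measurable_tsum_nrm :
    Measurable fun x : ℤ → E => ∑' h : ℤ, ENNReal.ofReal (K.nrm (x h) ^ α) :=
  .tsum fun h => ((K.measurable_nrm_apply h).pow_const α).ennreal_ofReal

lemma tsum_nrm_seqShift (k : ℤ) (x : ℤ → E) :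
    ∑' h : ℤ, ENNReal.ofReal (K.nrm (seqShift k x h) ^ α)
      = ∑' h : ℤ, ENNReal.ofReal (K.nrm (x h) ^ α) :=
  (Equiv.subRight k).tsum_eq fun h => ENNReal.ofReal (K.nrm (x h) ^ α)

lemma tsum_nrm_sSmul {u : ℝ} (hu : 0 < u) (x : ℤ → E) :
    ∑' h : ℤ, ENNReal.ofReal (K.nrm (K.sSmul u x h) ^ α)
      = ENNReal.ofReal (u ^ α) * ∑' h : ℤ, ENNReal.ofReal (K.nrm (x h) ^ α) := by
  rw [← ENNReal.tsum_mul_left]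
  refine tsum_congr fun h => ?_
  rw [K.nrm_sSmul hu, Real.mul_rpow hu.le (K.nrm_nonneg _), ENNReal.ofReal_mul (by positivity)]

lemma tsum_nrm_sSmul_eq_top {u : ℝ} (hu : 0 < u) {x : ℤ → E} :
    ∑' h : ℤ, ENNReal.ofReal (K.nrm (K.sSmul u x h) ^ α) = ∞
      ↔ ∑' h : ℤ, ENNReal.ofReal (K.nrm (x h) ^ α) = ∞ := by
  have : 0 < u ^ α := Real.rpow_pos_of_pos hu α
  rw [tsum_nrm_sSmul hu, ENNReal.mul_eq_top]
  simp [this]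

lemma ofReal_rpow_le_tsum_dyadic (hα : 0 < α) {t : ℝ} (ht : 0 ≤ t) :
    ENNReal.ofReal (t ^ α) ≤ ∑' j : ℤ, ENNReal.ofReal (((2 : ℝ) ^ (j + 1)) ^ α)
      * (Set.Ioi ((2 : ℝ) ^ j)).indicator 1 t := by
  rcases ht.eq_or_lt with rfl | ht
  · simp [Real.zero_rpow hα.ne']
  obtain ⟨j, hj, hj'⟩ := exists_mem_Ioc_zpow ht one_lt_two
  refine le_trans ?_ (ENNReal.le_tsum j)
  rw [Set.indicator_of_mem (Set.mem_Ioi.2 hj), Pi.one_apply, mul_one]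
  exact ENNReal.ofReal_le_ofReal (Real.rpow_le_rpow ht.le hj' hα.le)

end Summability

section Implications

variable {E : Type*} [MeasurableSpace E] {K : MeasCone E} {α : ℝ} {ν : Measure (ℤ → E)}

lemma tsum_measure_restrict_le_one (hν : K.IsTailMeasure α ν) (hs : ShiftInvariant ν)
    {C : Set (ℤ → E)} (hC : MeasurableSet C)
    (hdisj : ∀ h k : ℤ, h ≠ k → Disjoint (seqShift h '' C) (seqShift k '' C)) :
    ∑' h : ℤ, ν.restrict C {x | 1 < K.nrm (x h)} ≤ 1 := by
  have hU : ∀ h : ℤ, MeasurableSet {x : ℤ → E | 1 < K.nrm (x h)} := fun h =>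
    measurableSet_lt measurable_const (K.measurable_nrm_apply h)
  have hCh : ∀ h : ℤ, MeasurableSet (seqShift (-h) '' C) := fun h => by
    rw [image_seqShift]
    exact measurable_seqShift _ hC
  have hterm : ∀ h : ℤ, ν.restrict C {x | 1 < K.nrm (x h)}
      = ν ({x | 1 < K.nrm (x 0)} ∩ seqShift (-h) '' C) := fun h => by
    rw [Measure.restrict_apply (hU h), ← hs.measure_preimage (-h) ((hU 0).inter (hCh h)),
      image_seqShift]
    congr 1
    ext x
    simp [seqShift_seqShift, seqShift_zero, seqShift]
  simp_rw [hterm]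
  refine (tsum_meas_le_meas_iUnion_of_disjoint ν (fun h => (hU 0).inter (hCh h)) ?_).trans
    ((measure_mono (Set.iUnion_subset fun h => Set.inter_subset_left)).trans hν.2.1.le)
  exact fun h k hhk => (hdisj (-h) (-k) (neg_injective.ne hhk)).mono Set.inter_subset_right
    Set.inter_subset_right

lemma lintegral_tsum_nrm_le (hα : 0 < α) {μ : Measure (ℤ → E)}
    (hmap : ∀ u : ℝ, 0 < u → μ.map (K.sSmul u) = ENNReal.ofReal (u ^ α) • μ) (k : ℤ) :
    ∫⁻ x in {x | K.nrm (x k) ∈ Set.Ioc 1 2}, ∑' h : ℤ, ENNReal.ofReal (K.nrm (x h) ^ α) ∂μ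
      ≤ ENNReal.ofReal (2 ^ α) * ∑' h : ℤ, μ {x | 1 < K.nrm (x h)} := by
  set D : Set (ℤ → E) := {x | K.nrm (x k) ∈ Set.Ioc 1 2} with hDdef
  have hD : MeasurableSet D := K.measurable_nrm_apply k measurableSet_Ioc
  set U : ℤ → ℝ → Set (ℤ → E) := fun h t => {x | K.nrm (x h) ∈ Set.Ioi t} with hUdef
  have hU : ∀ h t, MeasurableSet (U h t) := fun h t => K.measurable_nrm_apply h measurableSet_Ioi
  have htwo : ∀ j : ℤ, (0 : ℝ) < 2 ^ j := fun j => zpow_pos two_pos j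
  have hscale : ∀ h j : ℤ, ENNReal.ofReal (((2 : ℝ) ^ (j + 1)) ^ α) * μ (U h (2 ^ j) ∩ D)
      = ENNReal.ofReal (2 ^ α) * μ (U h 1 ∩ K.sSmul (2 ^ j) ⁻¹' D) := fun h j => by
    have hpre : K.sSmul (2 ^ j) ⁻¹' (U h (2 ^ j) ∩ D) = U h 1 ∩ K.sSmul (2 ^ j) ⁻¹' D := by
      ext x
      simp [hUdef, K.nrm_sSmul (htwo j), htwo j]
    have happ := congrArg (fun m : Measure (ℤ → E) => m (U h (2 ^ j) ∩ D)) (hmap _ (htwo j))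
    simp only [Measure.smul_apply, smul_eq_mul] at happ
    rw [Measure.map_apply (K.measurable_sSmul _) ((hU _ _).inter hD), hpre] at happ
    rw [happ, ← mul_assoc, ← ENNReal.ofReal_mul (by positivity), zpow_add_one₀ two_ne_zero,
      Real.mul_rpow (htwo j).le two_pos.le, mul_comm ((2 : ℝ) ^ α)]
  have hdisj : ∀ h : ℤ, Pairwise (Function.onFun Disjoint
      fun j : ℤ => U h 1 ∩ K.sSmul (2 ^ j) ⁻¹' D) := fun h => by
    refine (pairwise_disjoint_on _).2 fun i j hij => Set.disjoint_left.2 fun x hxi hxj => ?_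
    have hi : 1 < 2 ^ i * K.nrm (x k) := by
      simpa only [K.nrm_sSmul (htwo i)] using hxi.2.1
    have hj : 2 ^ j * K.nrm (x k) ≤ 2 := by
      simpa only [K.nrm_sSmul (htwo j)] using hxj.2.2
    have hle : (2 : ℝ) ^ (i + 1) ≤ 2 ^ j := zpow_le_zpow_right₀ one_le_two hij
    rw [zpow_add_one₀ two_ne_zero] at hle
    nlinarith [K.nrm_nonneg (x k)]
  calc ∫⁻ x in D, ∑' h : ℤ, ENNReal.ofReal (K.nrm (x h) ^ α) ∂μ
      ≤ ∫⁻ x in D, ∑' h : ℤ, ∑' j : ℤ, ENNReal.ofReal (((2 : ℝ) ^ (j + 1)) ^ α)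
          * (U h (2 ^ j)).indicator 1 x ∂μ :=
        lintegral_mono fun x => ENNReal.tsum_le_tsum fun h =>
          ofReal_rpow_le_tsum_dyadic hα (K.nrm_nonneg (x h))
    _ = ∑' h : ℤ, ∑' j : ℤ, ENNReal.ofReal (((2 : ℝ) ^ (j + 1)) ^ α) * μ (U h (2 ^ j) ∩ D) := by
        have hm : ∀ h j : ℤ, Measurable fun x => ENNReal.ofReal (((2 : ℝ) ^ (j + 1)) ^ α)
            * (U h (2 ^ j)).indicator 1 x := fun h j =>
          (measurable_one.indicator (hU h _)).const_mul _
        rw [lintegral_tsum fun h => (Measurable.tsum fun j => hm h j).aemeasurable]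
        refine tsum_congr fun h => ?_
        rw [lintegral_tsum fun j => (hm h j).aemeasurable]
        refine tsum_congr fun j => ?_
        rw [lintegral_const_mul _ (measurable_one.indicator (hU h _)),
          lintegral_indicator_one (hU h _), Measure.restrict_apply (hU h _)]
    _ = ENNReal.ofReal (2 ^ α) * ∑' h : ℤ, ∑' j : ℤ, μ (U h 1 ∩ K.sSmul (2 ^ j) ⁻¹' D) := by
        simp_rw [hscale, ENNReal.tsum_mul_left]
    _ ≤ ENNReal.ofReal (2 ^ α) * ∑' h : ℤ, μ {x | 1 < K.nrm (x h)} := by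
        gcongr with h
        refine (tsum_meas_le_meas_iUnion_of_disjoint μ
          (fun j => (hU h 1).inter (K.measurable_sSmul _ hD)) (hdisj h)).trans ?_
        exact measure_mono (Set.iUnion_subset fun j => Set.inter_subset_left)

lemma measure_tsum_nrm_eq_top (hα : 0 < α) {μ : Measure (ℤ → E)}
    (hmap : ∀ u : ℝ, 0 < u → μ.map (K.sSmul u) = ENNReal.ofReal (u ^ α) • μ)
    (hfin : ∑' h : ℤ, μ {x | 1 < K.nrm (x h)} ≠ ∞) :
    μ {x | ∑' h : ℤ, ENNReal.ofReal (K.nrm (x h) ^ α) = ∞} = 0 := by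
  set b : Set (ℤ → E) := {x | ∑' h : ℤ, ENNReal.ofReal (K.nrm (x h) ^ α) = ∞} with hbdef
  have hb : MeasurableSet b := measurable_tsum_nrm (measurableSet_singleton ∞)
  set D : ℤ → Set (ℤ → E) := fun k => {x | K.nrm (x k) ∈ Set.Ioc 1 2} with hDdef
  have hD : ∀ k, MeasurableSet (D k) := fun k => K.measurable_nrm_apply k measurableSet_Ioc
  have hnull : ∀ k, μ (b ∩ D k) = 0 := fun k => by
    have hlt := ae_lt_top measurable_tsum_nrm (((lintegral_tsum_nrm_le hα hmap k).trans_lt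
      (ENNReal.mul_lt_top ENNReal.ofReal_lt_top hfin.lt_top)).ne)
    rw [← Measure.restrict_apply hb]
    exact measure_mono_null (fun x (hx : _ = _) => by simp [hx]) (ae_iff.1 hlt)
  have hscale : ∀ k n : ℤ, μ (K.sSmul (2 ^ n) ⁻¹' (b ∩ D k)) = 0 := fun k n => by
    rw [← Measure.map_apply (K.measurable_sSmul _) (hb.inter (hD k)),
      hmap _ (zpow_pos two_pos n), Measure.smul_apply, hnull, smul_zero]
  refine measure_mono_null (fun x hx => ?_)
    (measure_iUnion_null fun k => measure_iUnion_null fun n => hscale k n)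
  obtain ⟨k, hk⟩ : ∃ k, 0 < K.nrm (x k) := by
    by_contra! h
    have h0 : ∀ k, K.nrm (x k) = 0 := fun k => (h k).antisymm (K.nrm_nonneg _)
    simp [hbdef, h0, Real.zero_rpow hα.ne'] at hx
  obtain ⟨j, hj, hj'⟩ := exists_mem_Ioc_zpow hk one_lt_two
  have htwo : (0 : ℝ) < 2 ^ j := zpow_pos two_pos j
  refine Set.mem_iUnion₂.2 ⟨k, -j, (tsum_nrm_sSmul_eq_top (zpow_pos two_pos _)).2 hx, ?_⟩
  rw [zpow_add_one₀ two_ne_zero] at hj'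
  rw [hDdef, Set.mem_ofPred_eq, K.nrm_sSmul (zpow_pos two_pos (-j)), zpow_neg]
  exact ⟨(lt_inv_mul_iff₀ htwo).2 (by simpa using hj), (inv_mul_le_iff₀ htwo).2 hj'⟩

lemma compl_tsum_nrm_lt_top :
    {x : ℤ → E | (∑' h : ℤ, ENNReal.ofReal (K.nrm (x h) ^ α)) < ∞}ᶜ
      = {x | ∑' h : ℤ, ENNReal.ofReal (K.nrm (x h) ^ α) = ∞} := by
  ext x
  simp

lemma measure_tsum_nrm_of_dissipative (hα : 0 < α) (hν : K.IsTailMeasure α ν)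
    (hs : ShiftInvariant ν) {C : Set (ℤ → E)} (hC : MeasurableSet C)
    (hcone : ∀ u : ℝ, 0 < u → ∀ x ∈ C, K.sSmul u x ∈ C)
    (hdisj : ∀ h k : ℤ, h ≠ k → Disjoint (seqShift h '' C) (seqShift k '' C))
    (hcover : ν (⋃ h : ℤ, seqShift h '' C)ᶜ = 0) :
    ν {x | (∑' h : ℤ, ENNReal.ofReal (K.nrm (x h) ^ α)) < ∞}ᶜ = 0 := by
  rw [compl_tsum_nrm_lt_top]
  set b : Set (ℤ → E) := {x | ∑' h : ℤ, ENNReal.ofReal (K.nrm (x h) ^ α) = ∞} with hbdef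
  have hb : MeasurableSet b := measurable_tsum_nrm (measurableSet_singleton ∞)
  have hnull : ν (b ∩ C) = 0 := by
    rw [← Measure.restrict_apply hb]
    exact measure_tsum_nrm_eq_top hα
      (fun u hu => map_sSmul_restrict hu (hν.map_sSmul hu) hC hcone)
      ((tsum_measure_restrict_le_one hν hs hC hdisj).trans_lt ENNReal.one_lt_top).ne
  have hshift : ∀ h : ℤ, ν (seqShift (-h) ⁻¹' (b ∩ C)) = 0 := fun h => by
    rw [hs.measure_preimage _ (hb.inter hC), hnull]
  refine measure_mono_null (fun x hx => ?_)
    (measure_union_null hcover (measure_iUnion_null hshift))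
  by_cases hxC : x ∈ ⋃ h : ℤ, seqShift h '' C
  · obtain ⟨h, hh⟩ := Set.mem_iUnion.1 hxC
    rw [image_seqShift] at hh
    refine Or.inr (Set.mem_iUnion.2 ⟨h, ?_, hh⟩)
    rw [hbdef, Set.mem_ofPred_eq, tsum_nrm_seqShift]
    exact hx
  · exact Or.inl hxC

lemma lintegral_measure_one_lt_mul (hα : 0 < α) {ρ : Measure (ℤ → E)} [SFinite ρ] (k : ℤ) :
    ∫⁻ r in Set.Ioi (0 : ℝ), ρ {z | 1 < r * K.nrm (z k)} * ENNReal.ofReal (α * r ^ (-α - 1))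
      = ∫⁻ z, ENNReal.ofReal (K.nrm (z k) ^ α) ∂ρ := by
  set S : Set (ℝ × (ℤ → E)) := {p | 1 < p.1 * K.nrm (p.2 k)} with hSdef
  have hS : MeasurableSet S := measurableSet_lt measurable_const
    (measurable_fst.mul ((K.measurable_nrm_apply k).comp measurable_snd))
  have hw : Measurable fun r : ℝ => ENNReal.ofReal (α * r ^ (-α - 1)) := by fun_prop
  have hSind : Measurable (S.indicator (1 : ℝ × (ℤ → E) → ℝ≥0∞)) := measurable_one.indicator hS
  calc ∫⁻ r in Set.Ioi (0 : ℝ), ρ {z | 1 < r * K.nrm (z k)} * ENNReal.ofReal (α * r ^ (-α - 1))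
      = ∫⁻ r in Set.Ioi (0 : ℝ), ∫⁻ z, S.indicator 1 (r, z)
          * ENNReal.ofReal (α * r ^ (-α - 1)) ∂ρ := by
        refine lintegral_congr fun r => ?_
        have hSr : Measurable fun z => S.indicator (1 : ℝ × (ℤ → E) → ℝ≥0∞) (r, z) :=
          hSind.comp measurable_prodMk_left
        rw [lintegral_mul_const _ hSr]
        exact congrArg (· * _) (lintegral_indicator_one (measurable_prodMk_left hS)).symm
    _ = ∫⁻ z, (∫⁻ r in Set.Ioi (0 : ℝ), S.indicator 1 (r, z)
          * ENNReal.ofReal (α * r ^ (-α - 1)) ∂volume) ∂ρ :=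
        lintegral_lintegral_swap (hSind.mul (hw.comp measurable_fst)).aemeasurable
    _ = ∫⁻ z, ENNReal.ofReal (K.nrm (z k) ^ α) ∂ρ := by
        refine lintegral_congr fun z => ?_
        rcases (K.nrm_nonneg (z k)).eq_or_lt with h0 | hpos
        · simp [hSdef, ← h0, Real.zero_rpow hα.ne']
        have hind : ∀ r, S.indicator 1 (r, z) * ENNReal.ofReal (α * r ^ (-α - 1))
            = (Set.Ioi (K.nrm (z k))⁻¹).indicator
              (fun r => ENNReal.ofReal (α * r ^ (-α - 1))) r := fun r => by
          by_cases hr : (K.nrm (z k))⁻¹ < r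
          · have : (r, z) ∈ S := (inv_lt_iff_one_lt_mul₀ hpos).1 hr
            simp [this, hr]
          · have : (r, z) ∉ S := fun h => hr ((inv_lt_iff_one_lt_mul₀ hpos).2 h)
            simp [this, hr]
        simp_rw [hind]
        rw [lintegral_indicator measurableSet_Ioi, Measure.restrict_restrict measurableSet_Ioi,
          Set.inter_eq_left.2 (Set.Ioi_subset_Ioi (inv_pos.2 hpos).le),
          lintegral_Ioi_mul_rpow hα (inv_pos.2 hpos), Real.inv_rpow hpos.le,
          Real.rpow_neg hpos.le, inv_inv]

lemma measure_tsum_nrm_of_movingShift (hα : 0 < α) (hν : K.IsTailMeasure α ν)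
    {ρ : Measure (ℤ → E)} [IsProbabilityMeasure ρ]
    (hρ : ∀ A : Set (ℤ → E), MeasurableSet A →
      ν A = ∑' h : ℤ, ∫⁻ r in Set.Ioi (0 : ℝ), ρ {z | K.sSmul r (seqShift h z) ∈ A}
        * ENNReal.ofReal (α * r ^ (-α - 1)) ∂volume) :
    ν {x | (∑' h : ℤ, ENNReal.ofReal (K.nrm (x h) ^ α)) < ∞}ᶜ = 0 := by
  have hone : ∫⁻ z, ∑' h : ℤ, ENNReal.ofReal (K.nrm (z h) ^ α) ∂ρ = 1 := by
    rw [lintegral_tsum fun h =>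
        ((K.measurable_nrm_apply h).pow_const α).ennreal_ofReal.aemeasurable, ← hν.2.1,
      hρ _ (measurableSet_lt measurable_const (K.measurable_nrm_apply 0)),
      ← (Equiv.neg ℤ).tsum_eq]
    refine tsum_congr fun h => ?_
    rw [← lintegral_measure_one_lt_mul hα]
    refine setLIntegral_congr_fun measurableSet_Ioi fun r (hr : 0 < r) => ?_
    simp [K.nrm_sSmul hr, seqShift]
  have hnull : ρ {z | ∑' h : ℤ, ENNReal.ofReal (K.nrm (z h) ^ α) = ∞} = 0 := by
    have hlt := ae_lt_top measurable_tsum_nrm (hone ▸ ENNReal.one_ne_top)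
    exact measure_mono_null (fun x (hx : _ = _) => by simp [hx]) (ae_iff.1 hlt)
  have hb : MeasurableSet {x : ℤ → E | ∑' h : ℤ, ENNReal.ofReal (K.nrm (x h) ^ α) = ∞} :=
    measurable_tsum_nrm (measurableSet_singleton ∞)
  rw [compl_tsum_nrm_lt_top, hρ _ hb, ENNReal.tsum_eq_zero]
  refine fun h => (setLIntegral_congr_fun measurableSet_Ioi fun r (hr : 0 < r) => ?_).trans
    lintegral_zero
  simp only [Set.mem_ofPred_eq, tsum_nrm_sSmul_eq_top hr, tsum_nrm_seqShift, hnull, zero_mul]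

lemma exists_movingShift_of_infArgmax (hα : 0 < α) (hν : K.IsTailMeasure α ν)
    (hs : ShiftInvariant ν) (hI : ν {x | ∃ j : ℤ, K.IsInfArgmax x j}ᶜ = 0) :
    ∃ ρ : Measure (ℤ → E), IsProbabilityMeasure ρ ∧ ∀ A : Set (ℤ → E), MeasurableSet A →
      ν A = ∑' h : ℤ, ∫⁻ r in Set.Ioi (0 : ℝ), ρ {z | K.sSmul r (seqShift h z) ∈ A}
        * ENNReal.ofReal (α * r ^ (-α - 1)) ∂volume := by
  set C : Set (ℤ → E) := {x | K.IsInfArgmax x 0} with hCdef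
  have hC : MeasurableSet C := measurableSet_isInfArgmax 0
  have hmap : ∀ u : ℝ, 0 < u →
      (ν.restrict C).map (K.sSmul u) = ENNReal.ofReal (u ^ α) • ν.restrict C := fun u hu =>
    map_sSmul_restrict hu (hν.map_sSmul hu) hC fun u hu x hx => isInfArgmax_sSmul hu hx
  have hsum : ∀ A : Set (ℤ → E), MeasurableSet A →
      ν A = ∑' h : ℤ, ν.restrict C (seqShift h ⁻¹' A) := fun A hA => by
    have hJ : ∀ j : ℤ, MeasurableSet (A ∩ {x | K.IsInfArgmax x j}) := fun j =>
      hA.inter (measurableSet_isInfArgmax j)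
    have hunion : ν A = ν (⋃ j : ℤ, A ∩ {x | K.IsInfArgmax x j}) := by
      rw [← Set.inter_iUnion, ← Set.ofPred_exists, measure_inter_conull hI]
    rw [hunion, measure_iUnion (fun i j hij => Set.disjoint_left.2 fun x hi hj =>
      hij (hi.2.unique hj.2)) hJ]
    refine tsum_congr fun h => ?_
    rw [Measure.restrict_apply (measurable_seqShift h hA), ← hs.measure_preimage h (hJ h)]
    congr 1
    ext x
    simp [hCdef, isInfArgmax_seqShift]
  have hpos : ∀ᵐ x ∂ν.restrict C, 0 < K.nrm (x 0) := by
    filter_upwards [ae_restrict_mem hC] with x hx using hx.nrm_pos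
  set p : ℝ≥0∞ := ν.restrict C {x | 1 < K.nrm (x 0)} with hpdef
  have hp_top : p ≠ ∞ := ((Measure.restrict_apply_le _ _).trans_lt (hν.2.2.1 0)).ne
  have hmod : Measurable fun x : ℤ → E => K.nrm (x 0) := K.measurable_nrm_apply 0
  have hp_zero : p ≠ 0 := fun hp => by
    have hn : ∀ n : ℕ, ν.restrict C {x | (1 / (n + 1) : ℝ) < K.nrm (x 0)} = 0 := fun n => by
      rw [measure_rpow_scaling hmap hmod (fun u hu x => K.nrm_sSmul hu x 0)
        Nat.one_div_pos_of_nat, ← hpdef, hp, mul_zero]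
    have hzero : ν.restrict C = 0 := by
      rw [← Measure.measure_univ_eq_zero]
      refine measure_mono_null (fun x _ => ?_)
        (measure_union_null (ae_iff.1 hpos) (measure_iUnion_null hn))
      by_cases hx : 0 < K.nrm (x 0)
      · obtain ⟨n, hn⟩ := exists_nat_one_div_lt hx
        exact Or.inr (Set.mem_iUnion.2 ⟨n, hn⟩)
      · exact Or.inl hx
    have h := hsum {x | 1 < K.nrm (x 0)} (measurableSet_lt measurable_const hmod)
    rw [hν.2.1] at h
    simp only [hzero, Measure.coe_zero, Pi.zero_apply, tsum_zero, one_ne_zero] at h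
  have hp_pos : 0 < p.toReal := ENNReal.toReal_pos hp_zero hp_top
  set c : ℝ := p.toReal ^ α⁻¹ with hcdef
  have hc : 0 < c := Real.rpow_pos_of_pos hp_pos _
  obtain ⟨ρ, hρ, hpolar⟩ := exists_polar_decomposition (q := fun x => c⁻¹ * K.nrm (x 0)) hα hmap
    (hmod.const_mul _) (fun u hu x => by rw [K.nrm_sSmul hu]; ring)
    (hpos.mono fun x hx => mul_pos (inv_pos.2 hc) hx) (by
      simp only [lt_inv_mul_iff₀ hc, mul_one]
      rw [measure_rpow_scaling hmap hmod (fun u hu x => K.nrm_sSmul hu x 0) hc, ← hpdef,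
        Real.rpow_neg hc.le, hcdef, Real.rpow_inv_rpow hp_pos.le hα.ne',
        ENNReal.ofReal_inv_of_pos hp_pos, ENNReal.ofReal_toReal hp_top,
        ENNReal.inv_mul_cancel hp_zero hp_top])
  refine ⟨ρ, hρ, fun A hA => (hsum A hA).trans (tsum_congr fun h => ?_)⟩
  rw [hpolar _ (measurable_seqShift h hA)]
  rfl

end Implications

end MeasCone

open MeasCone in
/-- for a shift-invariant tail measure `ν`, the following are equivalent:
dissipativity; existence of a moving shift representation; `ν` is supported by
`{Σ ‖x_h‖^α < ∞}`; `ν` is supported by `{‖x_h‖ → 0 as |h| → ∞}`; `ν` is supported by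
`{I(x) ∈ ℤ}`. -/
theorem dissipative_tfae
    {E : Type*} [MeasurableSpace E] (K : MeasCone E) (α : ℝ) (hα : 0 < α)
    (ν : Measure (ℤ → E)) (hν : K.IsTailMeasure α ν) (hs : ShiftInvariant ν) :
    List.TFAE [
      (∃ C₀ : Set (ℤ → E), MeasurableSet C₀ ∧
        (∀ (u : ℝ), 0 < u → ∀ x ∈ C₀, K.sSmul u x ∈ C₀) ∧
        (∀ h k : ℤ, h ≠ k → Disjoint (seqShift h '' C₀) (seqShift k '' C₀)) ∧
        ν ((⋃ h : ℤ, seqShift h '' C₀)ᶜ) = 0),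
      (∃ ρ : Measure (ℤ → E), IsProbabilityMeasure ρ ∧
        ∀ A : Set (ℤ → E), MeasurableSet A →
          ν A = ∑' h : ℤ, ∫⁻ r in Set.Ioi (0 : ℝ),
            ρ {z | K.sSmul r (seqShift h z) ∈ A}
              * ENNReal.ofReal (α * r ^ (-α - 1)) ∂volume),
      ν {x | (∑' h : ℤ, ENNReal.ofReal (K.nrm (x h) ^ α)) < ⊤}ᶜ = 0,
      ν {x | Filter.Tendsto (fun h : ℤ => K.nrm (x h)) Filter.cofinite (nhds 0)}ᶜ = 0,
      ν {x | ∃ j : ℤ, K.IsInfArgmax x j}ᶜ = 0 ] := by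
  tfae_have 1 → 3 := fun ⟨C, hC, hcone, hdisj, hcover⟩ =>
    measure_tsum_nrm_of_dissipative hα hν hs hC hcone hdisj hcover
  tfae_have 2 → 3 := fun ⟨ρ, _, hρ⟩ => measure_tsum_nrm_of_movingShift hα hν hρ
  tfae_have 3 → 4 := fun h =>
    measure_mono_null (Set.compl_subset_compl.2 fun _ hx => tendsto_nrm_of_tsum_lt_top hα hx) h
  tfae_have 4 → 5 := fun h => by
    refine measure_mono_null (fun x hx => ?_) (measure_union_null hν.1 h)
    by_cases hx0 : x = K.zeroSeq
    · exact Or.inl hx0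
    · exact Or.inr fun hlim => hx (exists_isInfArgmax_of_tendsto hx0 hlim)
  tfae_have 5 → 1 := fun h => by
    refine ⟨{x | K.IsInfArgmax x 0}, measurableSet_isInfArgmax 0,
      fun u hu x hx => isInfArgmax_sSmul hu hx, fun i j hij => ?_, ?_⟩
    · rw [image_seqShift_isInfArgmax, image_seqShift_isInfArgmax]
      exact Set.disjoint_left.2 fun x hi hj => hij (hi.unique hj)
    · refine measure_mono_null (Set.compl_subset_compl.2 fun x hx => ?_) h
      obtain ⟨j, hj⟩ := hx
      exact Set.mem_iUnion.2 ⟨j, by rwa [image_seqShift_isInfArgmax]⟩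
  tfae_have 5 → 2 := exists_movingShift_of_infArgmax hα hν hs
  tfae_finish
end

section
/- Let X = (X_h)_{h∈ℤ} be an E^ℤ-valued random element which is regularly varying with normalizing sequence (a_n) and tail measure ν, i.e. n·P(a_n^{−1}X ∈ A) → ν(A) for every Borel A ⊆ E^ℤ separated from the zero sequence with ν(∂A) = 0 (where a_n is chosen so that n·P(‖X_0‖ > a_n) → 1). Then for every h ∈ ℤ, lim_{n→∞} n·P(‖X_h‖ > a_n) = p_h := ν({x : ‖x_h‖ > 1}), and for every h with p_h > 0, the conditional law of X/u given ‖X_h‖ > u converges weakly on (E^ℤ, d_F) as u → ∞ to the law of the local tail process Y^{(h)} of ν at lag h. -/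
open MeasureTheory
open scoped ENNReal NNReal

open Filter Topology Set ProbabilityTheory

section WeakConvergence

variable {ι S T S' : Type*}

/-- Converse portmanteau: convergence of the masses of all continuity sets implies weak
convergence. -/
theorem MeasureTheory.ProbabilityMeasure.tendsto_of_forall_null_frontier
    [TopologicalSpace S] [TopologicalSpace.PseudoMetrizableSpace S] [MeasurableSpace S]
    [BorelSpace S] {L : Filter ι} [L.IsCountablyGenerated]
    {μs : ι → ProbabilityMeasure S} {μ : ProbabilityMeasure S}
    (h : ∀ A, MeasurableSet A → (μ : Measure S) (frontier A) = 0 →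
      Tendsto (fun i => (μs i : Measure S) A) L (𝓝 ((μ : Measure S) A))) :
    Tendsto μs L (𝓝 μ) :=
  tendsto_of_forall_isOpen_le_liminf' fun G hG =>
    le_liminf_measure_open_of_forall_tendsto_measure (fun hA hA0 => h _ hA hA0) G hG

/-- If the rescaled measures `c i • m i` converge to `m₀` on the `m₀`-continuity sets contained in
`B`, then the conditional laws given `B` converge weakly. -/
theorem tendsto_cond_of_tendsto_mul_measure
    [TopologicalSpace S] [TopologicalSpace.PseudoMetrizableSpace S] [MeasurableSpace S]
    [BorelSpace S] {L : Filter ι} [L.IsCountablyGenerated]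
    {m : ι → Measure S} {m₀ : Measure S} {c : ι → ℝ≥0∞} {B : Set S} (hB : MeasurableSet B)
    (hB_frontier : m₀ (frontier B) = 0) (hB₀ : m₀ B ≠ 0) (hB_top : m₀ B ≠ ∞)
    (hc₀ : ∀ᶠ i in L, c i ≠ 0) (hc_top : ∀ᶠ i in L, c i ≠ ∞)
    (h : ∀ A, MeasurableSet A → A ⊆ B → m₀ (frontier A) = 0 →
      Tendsto (fun i => c i * m i A) L (𝓝 (m₀ A)))
    (hm : ∀ i, IsProbabilityMeasure ((m i)[|B])) (hm₀ : IsProbabilityMeasure (m₀[|B])) :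
    Tendsto (β := ProbabilityMeasure S) (fun i => ⟨(m i)[|B], hm i⟩) L (𝓝 ⟨m₀[|B], hm₀⟩) := by
  refine ProbabilityMeasure.tendsto_of_forall_null_frontier fun A hA hA0 => ?_
  simp only [ProbabilityMeasure.coe_mk] at hA0 ⊢
  have hBA : m₀ (frontier (B ∩ A)) = 0 := by
    rw [cond_apply hB] at hA0
    have hA1 : m₀ (B ∩ frontier A) = 0 := by
      rcases mul_eq_zero.1 hA0 with h0 | h0
      · exact absurd (ENNReal.inv_eq_zero.1 h0) hB_top
      · exact h0
    refine measure_mono_null (t := frontier B ∪ B ∩ frontier A) ?_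
      (measure_union_null hB_frontier hA1)
    intro x hx
    rcases frontier_inter_subset B A hx with hx | hx
    · exact Or.inl hx.1
    · by_cases hxB : x ∈ B
      · exact Or.inr ⟨hxB, hx.2⟩
      · exact Or.inl ⟨hx.1, fun hi => hxB (interior_subset hi)⟩
  have h1 := h B hB subset_rfl hB_frontier
  have h2 := h (B ∩ A) (hB.inter hA) inter_subset_left hBA
  have h3 := ENNReal.Tendsto.mul (tendsto_inv_iff.2 h1) (Or.inr
    (measure_ne_top_of_subset inter_subset_left hB_top)) h2 (Or.inr (ENNReal.inv_ne_top.2 hB₀))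
  rw [cond_apply hB]
  refine h3.congr' ?_
  filter_upwards [hc₀, hc_top] with i hi0 hit
  rw [cond_apply hB, ENNReal.mul_inv (Or.inl hi0) (Or.inl hit), mul_mul_mul_comm,
    ENNReal.inv_mul_cancel hi0 hit, one_mul]

/-- Continuous mapping theorem with a convergent deterministic parameter. -/
theorem MeasureTheory.ProbabilityMeasure.tendsto_map_of_tendsto_param
    [TopologicalSpace S] [TopologicalSpace.PseudoMetrizableSpace S] [SecondCountableTopology S]
    [MeasurableSpace S] [BorelSpace S]
    [TopologicalSpace T] [TopologicalSpace.PseudoMetrizableSpace T] [SecondCountableTopology T]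
    [MeasurableSpace T] [BorelSpace T]
    [TopologicalSpace S'] [MeasurableSpace S'] [BorelSpace S']
    {L : Filter ι} {μs : ι → ProbabilityMeasure S} {μ : ProbabilityMeasure S}
    (hμ : Tendsto μs L (𝓝 μ)) {t : ι → T} {t₀ : T} (ht : Tendsto t L (𝓝 t₀))
    {g : T × S → S'} (hg : Continuous g) :
    Tendsto (fun i => (μs i).map (f := fun x => g (t i, x))
        (hg.comp (by fun_prop)).aemeasurable) L
      (𝓝 (μ.map (f := fun x => g (t₀, x)) (hg.comp (by fun_prop)).aemeasurable)) := by
  have hp := (ProbabilityMeasure.continuous_prod.tendsto (diracProba t₀, μ)).comp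
    (((continuous_diracProba.tendsto t₀).comp ht).prodMk_nhds hμ)
  have hq := ProbabilityMeasure.tendsto_map_of_tendsto_of_continuous _ _ hp hg
  have key : ∀ (s : T) (κ : ProbabilityMeasure S),
      ((diracProba s).prod κ).map hg.measurable.aemeasurable
      = κ.map (f := fun x => g (s, x)) (hg.comp (by fun_prop)).aemeasurable := by
    intro s κ
    apply Subtype.ext
    change ((Measure.dirac s).prod (κ : Measure S)).map g = (κ : Measure S).map _
    rw [Measure.dirac_prod, Measure.map_map hg.measurable (by fun_prop)]
    rfl
  simpa only [Function.comp_def, key] using hq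

end WeakConvergence

section Scaling

variable {E : Type*} [MetricSpace E]

/-- A continuous action of the positive reals for which the distance to `z` is homogeneous. -/
structure IsPosScaling (smul : ℝ → E → E) (z : E) : Prop where
  continuousOn : ContinuousOn (fun p : ℝ × E => smul p.1 p.2) (Ioi 0 ×ˢ univ)
  one_smul : ∀ x, smul 1 x = x
  smul_smul : ∀ u v : ℝ, 0 < u → 0 < v → ∀ x, smul u (smul v x) = smul (u * v) x
  dist_smul : ∀ u : ℝ, 0 < u → ∀ x, dist z (smul u x) = u * dist z x

/-- The sequences whose coordinate at lag `h` exceeds the level `t`. -/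
def exceedance (z : E) (t : ℝ) (h : ℤ) : Set (ℤ → E) := {x | t < dist z (x h)}

theorem isOpen_exceedance (z : E) (t : ℝ) (h : ℤ) : IsOpen (exceedance z t h) :=
  isOpen_lt continuous_const (by fun_prop)

theorem exceedance_anti (z : E) (h : ℤ) {s t : ℝ} (hst : s ≤ t) :
    exceedance z t h ⊆ exceedance z s h := fun _ hx => hst.trans_lt hx

theorem measurableSet_exceedance [SecondCountableTopology E] [MeasurableSpace E] [BorelSpace E]
    (z : E) (t : ℝ) (h : ℤ) : MeasurableSet (exceedance z t h) :=
  (isOpen_exceedance z t h).measurableSet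

theorem frontier_exceedance_subset (z : E) (t : ℝ) (h : ℤ) :
    frontier (exceedance z t h) ⊆ {x | dist z (x h) = t} := fun _ hx =>
  (frontier_lt_subset_eq (f := fun _ : ℤ → E => t) (g := fun x => dist z (x h))
    continuous_const (by fun_prop) hx).symm

/-- A set contained in an exceedance set is separated from the zero sequence. -/
theorem exists_pos_le_tsum_of_subset_exceedance {z : E} {t : ℝ} (ht : 0 < t) {h : ℤ}
    {A : Set (ℤ → E)} (hA : A ⊆ exceedance z t h) :
    ∃ ε > 0, ∀ x ∈ A, ε ≤ ∑' j : ℤ, (2 : ℝ) ^ (-(|j| : ℤ)) * min (dist z (x j)) 1 := by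
  refine ⟨(2 : ℝ) ^ (-(|h| : ℤ)) * min t 1, by positivity, fun x hx => ?_⟩
  have hgeom : Summable fun j : ℤ => (2 : ℝ) ^ (-(|j| : ℤ)) := by
    have hn : Summable fun n : ℕ => (2 : ℝ) ^ (-(n : ℤ)) := by
      simpa [← inv_pow] using
        summable_geometric_of_lt_one (r := (2⁻¹ : ℝ)) (by norm_num) (by norm_num)
    exact Summable.of_nat_of_neg (by simpa using hn) (by simpa using hn)
  have hsum : Summable fun j : ℤ => (2 : ℝ) ^ (-(|j| : ℤ)) * min (dist z (x j)) 1 :=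
    hgeom.of_nonneg_of_le (fun j => by positivity)
      fun j => mul_le_of_le_one_right (by positivity) (min_le_right _ _)
  calc (2 : ℝ) ^ (-(|h| : ℤ)) * min t 1
      ≤ (2 : ℝ) ^ (-(|h| : ℤ)) * min (dist z (x h)) 1 := by
        gcongr
        exact (hA hx).le
    _ ≤ _ := hsum.le_tsum h fun j _ => by positivity

namespace IsPosScaling

variable {smul : ℝ → E → E} {z : E}

theorem continuous_seq (hs : IsPosScaling smul z) :
    Continuous fun p : Ioi (0 : ℝ) × (ℤ → E) => fun j => smul (p.1 : ℝ) (p.2 j) :=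
  continuous_pi fun j => hs.continuousOn.comp_continuous
    (f := fun p : Ioi (0 : ℝ) × (ℤ → E) => ((p.1 : ℝ), p.2 j)) (by fun_prop)
    fun p => ⟨p.1.2, mem_univ _⟩

theorem continuous_seq_const (hs : IsPosScaling smul z) {u : ℝ} (hu : 0 < u) :
    Continuous fun (x : ℤ → E) (j : ℤ) => smul u (x j) :=
  hs.continuous_seq.comp (f := fun x => ((⟨u, hu⟩ : Ioi (0 : ℝ)), x)) (by fun_prop)

theorem image_setOf_dist (hs : IsPosScaling smul z) {u : ℝ} (hu : 0 < u) (h : ℤ) (p : ℝ → Prop) :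
    (fun (x : ℤ → E) j => smul u (x j)) '' {x | p (dist z (x h))}
      = {x | p (u⁻¹ * dist z (x h))} := by
  ext y
  constructor
  · rintro ⟨x, hx, rfl⟩
    simpa [hs.dist_smul u hu, hu.ne'] using hx
  · intro hy
    refine ⟨fun j => smul u⁻¹ (y j), ?_, funext fun j => ?_⟩
    · simpa [hs.dist_smul _ (inv_pos.2 hu)] using hy
    · simp [hs.smul_smul _ _ hu (inv_pos.2 hu), hu.ne', hs.one_smul]

theorem preimage_exceedance (hs : IsPosScaling smul z) {u : ℝ} (hu : 0 < u) (t : ℝ) (h : ℤ) :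
    (fun (x : ℤ → E) j => smul u⁻¹ (x j)) ⁻¹' exceedance z t h = exceedance z (u * t) h := by
  ext x
  simp only [exceedance, mem_preimage, mem_ofPred_eq, hs.dist_smul _ (inv_pos.2 hu)]
  rw [← div_eq_inv_mul, lt_div_iff₀' hu]

variable [SecondCountableTopology E] [MeasurableSpace E] [BorelSpace E]

/-- A homogeneous measure scales the mass of exceedance sets by the power function. -/
theorem measure_exceedance (hs : IsPosScaling smul z) {α : ℝ} {ν : Measure (ℤ → E)}
    (hν : ∀ u : ℝ, 0 < u → ∀ A : Set (ℤ → E), MeasurableSet A →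
      ν ((fun x (j : ℤ) => smul u (x j)) '' A) = ENNReal.ofReal (u ^ (-α)) * ν A)
    {t : ℝ} (ht : 0 < t) (h : ℤ) :
    ν (exceedance z t h) = ENNReal.ofReal (t ^ (-α)) * ν (exceedance z 1 h) := by
  rw [← hν t ht _ (measurableSet_exceedance z 1 h)]
  congr 1
  refine Eq.trans ?_ (hs.image_setOf_dist ht h (fun r => 1 < r)).symm
  ext x
  simp only [exceedance, mem_ofPred_eq]
  rw [← div_eq_inv_mul, one_lt_div ht]

/-- A homogeneous measure that is finite on an exceedance set does not charge the spheres. -/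
theorem measure_dist_eq (hs : IsPosScaling smul z) {α : ℝ} {ν : Measure (ℤ → E)} {h : ℤ}
    (hν : ∀ u : ℝ, 0 < u → ∀ A : Set (ℤ → E), MeasurableSet A →
      ν ((fun x (j : ℤ) => smul u (x j)) '' A) = ENNReal.ofReal (u ^ (-α)) * ν A)
    (hfin : ν (exceedance z 1 h) < ∞) {t : ℝ} (ht : 0 < t) :
    ν {x | dist z (x h) = t} = 0 := by
  have hfinite : IsFiniteMeasure (ν.restrict (exceedance z 1 h)) := ⟨by simpa using hfin⟩
  have hmeas : Measurable fun x : ℤ → E => dist z (x h) :=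
    (continuous_const.dist (continuous_apply h)).measurable
  obtain ⟨s, hs1, hs0⟩ : ∃ s : ℝ, 1 < s ∧
      ν.restrict (exceedance z 1 h) {x | dist z (x h) = s} = 0 := by
    by_contra! hcon
    have hcount : (Ioi (1 : ℝ)).Countable :=
      (Measure.countable_meas_level_set_pos (μ := ν.restrict (exceedance z 1 h)) hmeas).mono
        fun s hs1 => pos_iff_ne_zero.2 (hcon s hs1)
    have hvol := hcount.measure_zero volume
    simp at hvol
  have hmeas_eq : MeasurableSet {x : ℤ → E | dist z (x h) = s} := hmeas (measurableSet_singleton s)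
  rw [Measure.restrict_apply hmeas_eq, inter_eq_left.2] at hs0
  · have hspos : 0 < s := one_pos.trans hs1
    have hts : 0 < t / s := div_pos ht hspos
    have himage := hν (t / s) hts _ hmeas_eq
    rw [hs0, mul_zero, hs.image_setOf_dist hts h (fun r => r = s)] at himage
    refine Eq.trans (congrArg ν ?_) himage
    ext x
    simp only [mem_ofPred_eq]
    rw [← div_eq_inv_mul, div_eq_iff hts.ne', mul_div_cancel₀ _ hspos.ne']
  · intro x (hx : dist z (x h) = s)
    exact hs1.trans_eq hx.symm

end IsPosScaling

end Scaling

section NormalizingSequence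

/-- If a tail function decays strictly faster than a constant along multiples of a normalizing
sequence, consecutive terms of that sequence are asymptotically equivalent. -/
theorem tendsto_succ_div_of_tendsto_mul_tail {a : ℕ → ℝ} (ha_pos : ∀ n, 0 < a n)
    (ha_mono : Monotone a) {F : ℝ → ℝ≥0∞} (hF : Antitone F) {α : ℝ} (hα : 0 < α)
    (hone : Tendsto (fun n : ℕ => (n : ℝ≥0∞) * F (a n)) atTop (𝓝 1))
    (htail : ∀ r : ℝ, 1 < r →
      Tendsto (fun n : ℕ => (n : ℝ≥0∞) * F (r * a n)) atTop (𝓝 (ENNReal.ofReal (r ^ (-α))))) :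
    Tendsto (fun n => a (n + 1) / a n) atTop (𝓝 1) := by
  refine tendsto_order.2 ⟨fun r hr => Eventually.of_forall fun n => hr.trans_le ?_, fun r hr => ?_⟩
  · exact (one_le_div (ha_pos n)).2 (ha_mono n.le_succ)
  have hlt : ENNReal.ofReal (r ^ (-α)) < 1 := by
    rw [← ENNReal.ofReal_one]
    exact (ENNReal.ofReal_lt_ofReal_iff one_pos).2
      (Real.rpow_lt_one_of_one_lt_of_neg hr (neg_neg_of_pos hα))
  obtain ⟨q, hq, hq1⟩ := exists_between hlt
  have hsmall : Tendsto (fun n : ℕ => F (r * a n)) atTop (𝓝 0) := by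
    have hmul := ENNReal.Tendsto.mul ENNReal.tendsto_inv_nat_nhds_zero
      (Or.inr ENNReal.ofReal_ne_top) (htail r hr) (Or.inr ENNReal.zero_ne_top)
    rw [zero_mul] at hmul
    refine hmul.congr' ?_
    filter_upwards [eventually_ne_atTop 0] with n hn
    rw [← mul_assoc, ENNReal.inv_mul_cancel (by exact_mod_cast hn) (ENNReal.natCast_ne_top n),
      one_mul]
  have hsum : Tendsto (fun n : ℕ => ((n + 1 : ℕ) : ℝ≥0∞) * F (r * a n)) atTop
      (𝓝 (ENNReal.ofReal (r ^ (-α)))) := by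
    simpa [add_mul] using (htail r hr).add hsmall
  filter_upwards [hsum.eventually_lt_const hq,
    ((tendsto_add_atTop_iff_nat 1).2 hone).eventually_const_lt hq1] with n h1 h2
  rw [div_lt_iff₀ (ha_pos n)]
  by_contra! hle
  exact absurd (h1.trans h2) (not_lt.2 (by gcongr; exact hF hle))

theorem exists_nat_le_lt_succ {a : ℕ → ℝ} (ha_top : Tendsto a atTop atTop) {u : ℝ}
    (hu : a 0 ≤ u) : ∃ n, a n ≤ u ∧ u < a (n + 1) := by
  by_contra! hcon
  have hle : ∀ n, a n ≤ u := fun n => Nat.rec hu (fun n ih => hcon n ih) n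
  obtain ⟨n, hn⟩ := (ha_top.eventually_gt_atTop u).exists
  exact absurd hn (not_lt.2 (hle n))

variable {ι : Type*} {L : Filter ι} {a : ℕ → ℝ} {u : ι → ℝ} {n : ι → ℕ}

theorem tendsto_index_atTop (ha_mono : Monotone a) (hu : Tendsto u L atTop)
    (hlt : ∀ i, u i < a (n i + 1)) : Tendsto n L atTop := by
  refine tendsto_atTop.2 fun N => ?_
  filter_upwards [hu.eventually_ge_atTop (a N)] with i hi
  by_contra! hN
  exact absurd ((hlt i).trans_le (ha_mono hN)) (not_lt.2 hi)

theorem tendsto_index_div (ha_pos : ∀ n, 0 < a n) (hn : Tendsto n L atTop)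
    (hle : ∀ i, a (n i) ≤ u i) (hlt : ∀ i, u i < a (n i + 1))
    (hratio : Tendsto (fun n => a (n + 1) / a n) atTop (𝓝 1)) :
    Tendsto (fun i => a (n i) / u i) L (𝓝 1) := by
  have hinv := (hratio.comp hn).inv₀ one_ne_zero
  rw [inv_one] at hinv
  refine tendsto_of_tendsto_of_tendsto_of_le_of_le hinv tendsto_const_nhds (fun i => ?_) fun i => ?_
  · have hpos : 0 < u i := (ha_pos _).trans_le (hle i)
    simp only [Function.comp_apply, inv_div]
    exact div_le_div_of_nonneg_left (ha_pos _).le hpos (hlt i).le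
  · exact div_le_one_of_le₀ (hle i) ((ha_pos _).le.trans (hle i))

end NormalizingSequence

section Conditioning

variable {E : Type*} [MetricSpace E] [SecondCountableTopology E] [MeasurableSpace E] [BorelSpace E]
  {Ω : Type*} [MeasurableSpace Ω]

/-- The law of the sequence `X` divided by the level `u`. -/
noncomputable def scaledLaw (smul : ℝ → E → E) (P : Measure Ω) (X : Ω → ℤ → E) (u : ℝ) :
    Measure (ℤ → E) :=
  P.map fun ω j => smul u⁻¹ (X ω j)

variable {smul : ℝ → E → E} {z : E} {P : Measure Ω} {X : Ω → ℤ → E}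

namespace IsPosScaling

theorem scaledLaw_apply (hs : IsPosScaling smul z) (hX : Measurable X) {u : ℝ} (hu : 0 < u)
    {A : Set (ℤ → E)} (hA : MeasurableSet A) :
    scaledLaw smul P X u A = P {ω | (fun j => smul u⁻¹ (X ω j)) ∈ A} :=
  Measure.map_apply ((hs.continuous_seq_const (inv_pos.2 hu)).measurable.comp hX) hA

theorem scaledLaw_exceedance (hs : IsPosScaling smul z) (hX : Measurable X) {u : ℝ} (hu : 0 < u)
    (t : ℝ) (h : ℤ) :
    scaledLaw smul P X u (exceedance z t h) = P {ω | u * t < dist z (X ω h)} := by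
  rw [hs.scaledLaw_apply hX hu (measurableSet_exceedance z t h)]
  exact congrArg (fun s => P (X ⁻¹' s)) (hs.preimage_exceedance hu t h)

theorem map_scaledLaw (hs : IsPosScaling smul z) (hX : Measurable X) {u v : ℝ} (hu : 0 < u)
    (hv : 0 < v) :
    (scaledLaw smul P X v).map (fun x j => smul (v / u) (x j)) = scaledLaw smul P X u := by
  have hmeas : Measurable fun ω j => smul v⁻¹ (X ω j) :=
    (hs.continuous_seq_const (inv_pos.2 hv)).measurable.comp hX
  rw [scaledLaw, Measure.map_map (hs.continuous_seq_const (div_pos hv hu)).measurable hmeas,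
    scaledLaw]
  congr 1
  funext ω j
  simp only [Function.comp_apply]
  rw [hs.smul_smul _ _ (div_pos hv hu) (inv_pos.2 hv)]
  congr 1
  field_simp

theorem integral_cond_scaledLaw (hs : IsPosScaling smul z) (hX : Measurable X) {u : ℝ} (hu : 0 < u)
    (h : ℤ) (f : BoundedContinuousFunction (ℤ → E) ℝ) :
    ∫ y, f y ∂(scaledLaw smul P X u)[|exceedance z 1 h] =
      (∫ ω in {ω | u < dist z (X ω h)}, f (fun j => smul u⁻¹ (X ω j)) ∂P)
        / (P {ω | u < dist z (X ω h)}).toReal := by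
  have hmeas : Measurable fun ω j => smul u⁻¹ (X ω j) :=
    (hs.continuous_seq_const (inv_pos.2 hu)).measurable.comp hX
  rw [ProbabilityTheory.cond, integral_smul_measure, hs.scaledLaw_exceedance hX hu, scaledLaw,
    setIntegral_map (measurableSet_exceedance z 1 h)
      f.continuous.aestronglyMeasurable hmeas.aemeasurable, mul_one, ENNReal.toReal_inv,
    smul_eq_mul, div_eq_inv_mul]
  have hset : (fun ω j => smul u⁻¹ (X ω j)) ⁻¹' exceedance z 1 h = {ω | u < dist z (X ω h)} := by
    have hpre := congrArg (X ⁻¹' ·) (hs.preimage_exceedance hu 1 h)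
    rw [mul_one] at hpre
    exact hpre
  rw [hset]

/-- Weak convergence of the conditional laws of `X / u` given an exceedance of `u`, when `u` is
asymptotically equivalent to a subfamily of the normalizing sequence `a`. -/
theorem tendsto_integral_cond_scaledLaw [IsProbabilityMeasure P] (hs : IsPosScaling smul z)
    (hX : Measurable X) {ν : Measure (ℤ → E)} {h : ℤ}
    (hν_sphere : ∀ t : ℝ, 0 < t → ν {x | dist z (x h) = t} = 0)
    (hν_ne_zero : ∀ t : ℝ, 0 < t → ν (exceedance z t h) ≠ 0)
    (hν_ne_top : ∀ t : ℝ, 0 < t → ν (exceedance z t h) ≠ ∞)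
    (hP : ∀ s : ℝ, P {ω | s < dist z (X ω h)} ≠ 0)
    {a : ℕ → ℝ} (ha_pos : ∀ n, 0 < a n)
    (hconv : ∀ t : ℝ, 0 < t → ∀ A, MeasurableSet A → A ⊆ exceedance z t h → ν (frontier A) = 0 →
      Tendsto (fun n : ℕ => (n : ℝ≥0∞) * scaledLaw smul P X (a n) A) atTop (𝓝 (ν A)))
    {ι : Type*} {L : Filter ι} [L.IsCountablyGenerated] {u : ι → ℝ} {n : ι → ℕ}
    (hn : Tendsto n L atTop) (hle : ∀ i, a (n i) ≤ u i)
    (hdiv : Tendsto (fun i => a (n i) / u i) L (𝓝 1))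
    (f : BoundedContinuousFunction (ℤ → E) ℝ) :
    Tendsto (fun i => ∫ y, f y ∂(scaledLaw smul P X (u i))[|exceedance z 1 h]) L
      (𝓝 (∫ y, f y ∂ν[|exceedance z 1 h])) := by
  have hu_pos : ∀ i, 0 < u i := fun i => (ha_pos _).trans_le (hle i)
  have hlaw : ∀ s : ℝ, 0 < s → IsProbabilityMeasure (scaledLaw smul P X s) := fun s hs0 =>
    Measure.isProbabilityMeasure_map
      ((hs.continuous_seq_const (inv_pos.2 hs0)).measurable.comp hX).aemeasurable
  have hlaw_ne : ∀ s : ℝ, 0 < s → ∀ t, scaledLaw smul P X s (exceedance z t h) ≠ 0 :=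
    fun s hs0 t => by
      rw [hs.scaledLaw_exceedance hX hs0]
      exact hP _
  have hcond : ∀ s : ℝ, 0 < s → ∀ t,
      IsProbabilityMeasure ((scaledLaw smul P X s)[|exceedance z t h]) := fun s hs0 t =>
    have := hlaw s hs0
    cond_isProbabilityMeasure (hlaw_ne s hs0 t)
  have hνcond : ∀ t : ℝ, 0 < t → IsProbabilityMeasure (ν[|exceedance z t h]) := fun t ht =>
    cond_isProbabilityMeasure_of_finite (hν_ne_zero t ht) (hν_ne_top t ht)
  have hfrontier : ∀ t : ℝ, 0 < t → ν (frontier (exceedance z t h)) = 0 := fun t ht =>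
    measure_mono_null (frontier_exceedance_subset z t h) (hν_sphere t ht)
  set B : Set (ℤ → E) := exceedance z (1 / 2) h with hB_def
  have hB : MeasurableSet B := measurableSet_exceedance z _ h
  have hlevel := tendsto_cond_of_tendsto_mul_measure (m := fun n => scaledLaw smul P X (a n)) hB
    (hfrontier _ one_half_pos) (hν_ne_zero _ one_half_pos) (hν_ne_top _ one_half_pos)
    ((eventually_ne_atTop 0).mono fun n hn0 => by exact_mod_cast hn0)
    (Eventually.of_forall ENNReal.natCast_ne_top) (hconv _ one_half_pos)
    (fun n => hcond _ (ha_pos n) _) (hνcond _ one_half_pos)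
  have hparam : Tendsto (fun i => (⟨a (n i) / u i, div_pos (ha_pos _) (hu_pos i)⟩ : Ioi (0 : ℝ))) L
      (𝓝 ⟨1, mem_Ioi.2 one_pos⟩) := tendsto_subtype_rng.2 hdiv
  have hmap := ProbabilityMeasure.tendsto_map_of_tendsto_param (hlevel.comp hn) hparam
    hs.continuous_seq
  have hsets : ∀ A, MeasurableSet A → A ⊆ exceedance z 1 h → ν (frontier A) = 0 →
      Tendsto (fun i => (ν B * (scaledLaw smul P X (a (n i)) B)⁻¹) * scaledLaw smul P X (u i) A) L
        (𝓝 (ν A)) := by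
    intro A hA hA1 hA0
    have hlim : (ν[|B]).map (fun x j => smul 1 (x j)) = ν[|B] := by
      simp only [hs.one_smul]
      exact Measure.map_id
    have hAB : A ⊆ B := hA1.trans (exceedance_anti z h (by norm_num))
    have hA0' : (ν[|B]) (frontier A) = 0 := cond_absolutelyContinuous hA0
    have hset := ProbabilityMeasure.tendsto_measure_of_null_frontier_of_tendsto' hmap (E := A)
      ((congrArg (fun m : Measure (ℤ → E) => m (frontier A)) hlim).trans hA0')
    have hlim_apply : ν B * ((ν[|B]).map (fun x j => smul 1 (x j)) A) = ν A := by
      rw [hlim, cond_apply hB, inter_eq_right.2 hAB, ← mul_assoc,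
        ENNReal.mul_inv_cancel (hν_ne_zero _ one_half_pos) (hν_ne_top _ one_half_pos), one_mul]
    rw [← hlim_apply]
    refine (ENNReal.Tendsto.const_mul hset (Or.inr (hν_ne_top _ one_half_pos))).congr fun i => ?_
    change ν B * (((scaledLaw smul P X (a (n i)))[|B]).map
      (fun x j => smul (a (n i) / u i) (x j))) A = _
    have hcont := hs.continuous_seq_const (div_pos (ha_pos (n i)) (hu_pos i))
    rw [Measure.map_apply hcont.measurable hA, cond_apply hB, inter_eq_right.2, mul_assoc,
      ← Measure.map_apply hcont.measurable hA, hs.map_scaledLaw hX (hu_pos i) (ha_pos _)]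
    intro x hx
    have hx1 : 1 < dist z (smul (a (n i) / u i) (x h)) := hA1 hx
    rw [hs.dist_smul _ (div_pos (ha_pos _) (hu_pos i))] at hx1
    have hle1 : a (n i) / u i ≤ 1 := div_le_one_of_le₀ (hle i) (hu_pos i).le
    change 1 / 2 < dist z (x h)
    nlinarith [dist_nonneg (x := z) (y := x h)]
  have hfinal := tendsto_cond_of_tendsto_mul_measure (m := fun i => scaledLaw smul P X (u i))
    (measurableSet_exceedance z 1 h) (hfrontier 1 one_pos) (hν_ne_zero 1 one_pos)
    (hν_ne_top 1 one_pos)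
    (Eventually.of_forall fun i => mul_ne_zero (hν_ne_zero _ one_half_pos)
      (ENNReal.inv_ne_zero.2 (have := hlaw _ (ha_pos (n i)); measure_ne_top _ _)))
    (Eventually.of_forall fun i => ENNReal.mul_ne_top (hν_ne_top _ one_half_pos)
      (ENNReal.inv_ne_top.2 (hlaw_ne _ (ha_pos (n i)) _)))
    hsets (fun i => hcond _ (hu_pos i) 1) (hνcond 1 one_pos)
  exact ProbabilityMeasure.tendsto_iff_forall_integral_tendsto.1 hfinal f

end IsPosScaling

end Conditioning

/-- if the time series `X` is regularly varying with normalizing sequence `(a_n)`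
and tail measure `ν`, then `n·P(‖X_h‖ > a_n) → p_h = ν({x : ‖x_h‖ > 1})` for every `h`, and
for every `h` with `p_h > 0` the conditional law of `X/u` given `‖X_h‖ > u` converges weakly
(as `u → ∞`) to the law of the local tail process `Y^{(h)}` of `ν` at lag `h`. -/
theorem regvar_time_series_tail_process
    {E : Type*} [MetricSpace E] [CompleteSpace E] [TopologicalSpace.SeparableSpace E]
    [SecondCountableTopology E] [MeasurableSpace E] [BorelSpace E]
    -- scalar multiplication by positive reals, continuous, with ‖x‖ = dist(0_E, x) homogeneous
    (smul : ℝ → E → E) (z : E)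
    (hsc : ContinuousOn (fun p : ℝ × E => smul p.1 p.2) (Set.Ioi 0 ×ˢ Set.univ))
    (hone : ∀ x, smul 1 x = x)
    (hmul : ∀ (u v : ℝ), 0 < u → 0 < v → ∀ x, smul u (smul v x) = smul (u * v) x)
    (hz : ∀ (u : ℝ), 0 < u → smul u z = z)
    (hd : ∀ (u : ℝ), 0 < u → ∀ x, dist z (smul u x) = u * dist z x)
    {Ω : Type*} [MeasurableSpace Ω] (P : Measure Ω) [IsProbabilityMeasure P]
    (X : Ω → ℤ → E) (hX : Measurable X)
    (α : ℝ) (hα : 0 < α)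
    -- ν is a tail measure with index α
    (ν : Measure (ℤ → E))
    (hν_zero : ν {fun _ : ℤ => z} = 0)
    (hν_one : ν {x | 1 < dist z (x 0)} = 1)
    (hν_fin : ∀ h : ℤ, ν {x | 1 < dist z (x h)} < ⊤)
    (hν_hom : ∀ (u : ℝ), 0 < u → ∀ A : Set (ℤ → E), MeasurableSet A →
      ν ((fun x (j : ℤ) => smul u (x j)) '' A) = ENNReal.ofReal (u ^ (-α)) * ν A)
    -- the normalizing sequence, chosen so that n·P(‖X_0‖ > a_n) → 1
    (a : ℕ → ℝ) (ha_pos : ∀ n, 0 < a n) (ha_mono : Monotone a)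
    (ha_top : Filter.Tendsto a Filter.atTop Filter.atTop)
    (ha_norm : Filter.Tendsto (fun n : ℕ => (n : ℝ≥0∞) * P {ω | a n < dist z (X ω 0)})
      Filter.atTop (nhds 1))
    -- regular variation of X: n·P(a_n⁻¹ X ∈ A) → ν(A) for Borel A separated from the zero
    -- sequence (in the metric d_F) with ν(∂A) = 0
    (hRV : ∀ A : Set (ℤ → E), MeasurableSet A →
      (∃ ε > 0, ∀ x ∈ A, ε ≤ ∑' j : ℤ, (2 : ℝ) ^ (-(|j| : ℤ)) * min (dist z (x j)) 1) →
      ν (frontier A) = 0 →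
      Filter.Tendsto (fun n : ℕ => (n : ℝ≥0∞) * P {ω | (fun j => smul (a n)⁻¹ (X ω j)) ∈ A})
        Filter.atTop (nhds (ν A))) :
    (∀ h : ℤ, Filter.Tendsto (fun n : ℕ => (n : ℝ≥0∞) * P {ω | a n < dist z (X ω h)})
        Filter.atTop (nhds (ν {x | 1 < dist z (x h)}))) ∧
    ∀ h : ℤ, 0 < ν {x | 1 < dist z (x h)} →
      ∀ f : BoundedContinuousFunction (ℤ → E) ℝ,
        Filter.Tendsto (fun u : ℝ =>
            (∫ ω in {ω | u < dist z (X ω h)}, f (fun j => smul u⁻¹ (X ω j)) ∂P)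
              / (P {ω | u < dist z (X ω h)}).toReal)
          Filter.atTop
          (nhds (∫ y, f y
            ∂((ν {x | 1 < dist z (x h)})⁻¹ • ν.restrict {x | 1 < dist z (x h)}))) := by
  have hs : IsPosScaling smul z := ⟨hsc, hone, hmul, hd⟩
  have hsphere : ∀ (h : ℤ) (t : ℝ), 0 < t → ν {x | dist z (x h) = t} = 0 :=
    fun h t ht => hs.measure_dist_eq hν_hom (hν_fin h) ht
  have hconv : ∀ (h : ℤ) (t : ℝ), 0 < t → ∀ A, MeasurableSet A → A ⊆ exceedance z t h →
      ν (frontier A) = 0 →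
      Tendsto (fun n : ℕ => (n : ℝ≥0∞) * scaledLaw smul P X (a n) A) atTop (𝓝 (ν A)) := by
    intro h t ht A hA hAt hA0
    simp only [hs.scaledLaw_apply hX (ha_pos _) hA]
    exact hRV A hA (exists_pos_le_tsum_of_subset_exceedance ht hAt) hA0
  have htail : ∀ (h : ℤ) (t : ℝ), 0 < t →
      Tendsto (fun n : ℕ => (n : ℝ≥0∞) * P {ω | t * a n < dist z (X ω h)}) atTop
        (𝓝 (ν (exceedance z t h))) := by
    intro h t ht
    simpa only [hs.scaledLaw_exceedance hX (ha_pos _), mul_comm (a _) t] using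
      hconv h t ht _ (measurableSet_exceedance z t h) subset_rfl
        (measure_mono_null (frontier_exceedance_subset z t h) (hsphere h t ht))
  have hpart : ∀ h : ℤ, Tendsto (fun n : ℕ => (n : ℝ≥0∞) * P {ω | a n < dist z (X ω h)})
      atTop (𝓝 (ν {x | 1 < dist z (x h)})) := fun h => by
    simpa only [one_mul, exceedance] using htail h 1 one_pos
  refine ⟨hpart, fun h hpos f => ?_⟩
  have hanti : ∀ h : ℤ, Antitone fun s : ℝ => P {ω | s < dist z (X ω h)} :=
    fun h s t hst => measure_mono fun ω (hω : t < _) => hst.trans_lt hω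
  have hratio : Tendsto (fun n => a (n + 1) / a n) atTop (𝓝 1) := by
    refine tendsto_succ_div_of_tendsto_mul_tail ha_pos ha_mono (hanti 0) hα ha_norm fun r hr => ?_
    have hν0 : ν (exceedance z r 0) = ENNReal.ofReal (r ^ (-α)) :=
      (hs.measure_exceedance hν_hom (one_pos.trans hr) 0).trans
        ((congrArg _ hν_one).trans (mul_one _))
    exact hν0 ▸ htail 0 r (one_pos.trans hr)
  have hP : ∀ s : ℝ, P {ω | s < dist z (X ω h)} ≠ 0 := by
    intro s hs0
    obtain ⟨n, hn, hsn⟩ := (((hpart h).eventually_const_lt hpos).and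
      (ha_top.eventually_ge_atTop s)).exists
    have hzero : P {ω | a n < dist z (X ω h)} = 0 :=
      le_antisymm ((hanti h hsn).trans_eq hs0) zero_le
    simp [hzero] at hn
  have hν_ne_zero : ∀ t : ℝ, 0 < t → ν (exceedance z t h) ≠ 0 := fun t ht => by
    rw [hs.measure_exceedance hν_hom ht]
    exact mul_ne_zero (ENNReal.ofReal_pos.2 (by positivity)).ne' hpos.ne'
  have hν_ne_top : ∀ t : ℝ, 0 < t → ν (exceedance z t h) ≠ ∞ := fun t ht => by
    rw [hs.measure_exceedance hν_hom ht]
    exact ENNReal.mul_ne_top ENNReal.ofReal_ne_top (hν_fin h).ne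
  choose n hle hlt using fun u : ℝ => exists_nat_le_lt_succ ha_top (le_max_right u (a 0))
  have hn : Tendsto n atTop atTop :=
    tendsto_index_atTop ha_mono (tendsto_atTop_mono (fun u => le_max_left u (a 0)) tendsto_id) hlt
  have hlim := hs.tendsto_integral_cond_scaledLaw hX (hsphere h) hν_ne_zero hν_ne_top hP ha_pos
    (hconv h) hn hle (tendsto_index_div ha_pos hn hle hlt hratio) f
  refine hlim.congr' ?_
  filter_upwards [eventually_ge_atTop (a 0)] with u hu
  rw [max_eq_left hu]
  exact hs.integral_cond_scaledLaw hX ((ha_pos 0).trans_le hu) h f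
end
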